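/- arXiv:2406.02828 — 4 statements merged into one kernel-verified Lean document; each statement's English description precedes it below -/
import Mathlib

section
/- (Pohozaev-type identity, Theorem 2.1.) Let f : D → ℝⁿ be a smooth map on the open unit disk D ⊂ ℝ² which is an immersion, conformal in the sense that |∂_x f|² = |∂_y f|² = e^{2w} and ⟨∂_x f, ∂_y f⟩ = 0 for a smooth w : D → ℝ, and which satisfies the Willmore equation (the same pointwise fourth-order equation as on the cylinder, with the coordinates (x,y) in place of (t,θ) and conformal factor e^{2w}). Define f̂(t,θ) := f(e^{−t}cos θ, e^{−t}sin θ) for t > 0. Then f̂ is a conformal Willmore immersion on (0,∞)×S¹, and for every t > 0, every c ∈ ℝⁿ and every n×n real skew-symmetric matrix S one has τ₁(f̂,c)(t) = 0 and τ₂(f̂,S)(t) = 0. -/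
noncomputable section

open Real MeasureTheory Set Filter
open scoped InnerProductSpace

/-- Partial derivative in the first variable. -/
def pt {F : Type*} [NormedAddCommGroup F] [NormedSpace ℝ F] (f : ℝ → ℝ → F) (t θ : ℝ) : F :=
  deriv (fun s => f s θ) t

/-- Partial derivative in the second variable. -/
def pth {F : Type*} [NormedAddCommGroup F] [NormedSpace ℝ F] (f : ℝ → ℝ → F) (t θ : ℝ) : F :=
  deriv (fun s => f t s) θ

variable {n : ℕ}

/-- Mean curvature vector `H = e^{-2u}(∂_t² f + ∂_θ² f)`. -/
def Hmc (f : ℝ → ℝ → EuclideanSpace ℝ (Fin n)) (u : ℝ → ℝ → ℝ) :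
    ℝ → ℝ → EuclideanSpace ℝ (Fin n) :=
  fun t θ => Real.exp (-(2 * u t θ)) • (pt (pt f) t θ + pth (pth f) t θ)

/-- Component `A_tt` of the second fundamental form. -/
def Att (f : ℝ → ℝ → EuclideanSpace ℝ (Fin n)) (u : ℝ → ℝ → ℝ) :
    ℝ → ℝ → EuclideanSpace ℝ (Fin n) :=
  fun t θ => pt (pt f) t θ - pt u t θ • pt f t θ + pth u t θ • pth f t θ

/-- Component `A_tθ` of the second fundamental form. -/
def Atth (f : ℝ → ℝ → EuclideanSpace ℝ (Fin n)) (u : ℝ → ℝ → ℝ) :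
    ℝ → ℝ → EuclideanSpace ℝ (Fin n) :=
  fun t θ => pt (pth f) t θ - pth u t θ • pt f t θ - pt u t θ • pth f t θ

/-- Component `A_θθ` of the second fundamental form. -/
def Athth (f : ℝ → ℝ → EuclideanSpace ℝ (Fin n)) (u : ℝ → ℝ → ℝ) :
    ℝ → ℝ → EuclideanSpace ℝ (Fin n) :=
  fun t θ => pth (pth f) t θ + pt u t θ • pt f t θ - pth u t θ • pth f t θ

/-- `|A|²`, the squared norm of the second fundamental form. -/
def Asq (f : ℝ → ℝ → EuclideanSpace ℝ (Fin n)) (u : ℝ → ℝ → ℝ) : ℝ → ℝ → ℝ :=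
  fun t θ => Real.exp (-(4 * u t θ)) *
    (‖Att f u t θ‖ ^ 2 + 2 * ‖Atth f u t θ‖ ^ 2 + ‖Athth f u t θ‖ ^ 2)

/-- The left-hand side of the Willmore equation in conformal coordinates. -/
def willmoreOp (f : ℝ → ℝ → EuclideanSpace ℝ (Fin n)) (u : ℝ → ℝ → ℝ) :
    ℝ → ℝ → EuclideanSpace ℝ (Fin n) :=
  fun t θ =>
    (2 : ℝ) • (pt (pt (Hmc f u)) t θ + pth (pth (Hmc f u)) t θ)
    + (4 : ℝ) • pt (fun a b => Real.exp (-(2 * u a b)) •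
        (⟪Hmc f u a b, Att f u a b⟫_ℝ • pt f a b + ⟪Hmc f u a b, Atth f u a b⟫_ℝ • pth f a b)) t θ
    + (4 : ℝ) • pth (fun a b => Real.exp (-(2 * u a b)) •
        (⟪Hmc f u a b, Atth f u a b⟫_ℝ • pt f a b + ⟪Hmc f u a b, Athth f u a b⟫_ℝ • pth f a b)) t θ
    - pt (fun a b => ‖Hmc f u a b‖ ^ 2 • pt f a b) t θ
    - pth (fun a b => ‖Hmc f u a b‖ ^ 2 • pth f a b) t θ

/-- A conformal immersion of a cylinder `s × S¹` (in the `t` variable),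
with conformal factor `e^{2u}`; maps are `2π`-periodic in the second variable. -/
structure ConfImm (f : ℝ → ℝ → EuclideanSpace ℝ (Fin n)) (u : ℝ → ℝ → ℝ) (s : Set ℝ) :
    Prop where
  smooth_f : ContDiff ℝ (⊤ : ℕ∞) (fun p : ℝ × ℝ => f p.1 p.2)
  smooth_u : ContDiff ℝ (⊤ : ℕ∞) (fun p : ℝ × ℝ => u p.1 p.2)
  periodic_f : ∀ t θ, f t (θ + 2 * π) = f t θ
  periodic_u : ∀ t θ, u t (θ + 2 * π) = u t θ
  conf_t : ∀ t ∈ s, ∀ θ : ℝ, ‖pt f t θ‖ ^ 2 = Real.exp (2 * u t θ)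
  conf_th : ∀ t ∈ s, ∀ θ : ℝ, ‖pth f t θ‖ ^ 2 = Real.exp (2 * u t θ)
  conf_orth : ∀ t ∈ s, ∀ θ : ℝ, ⟪pt f t θ, pth f t θ⟫_ℝ = 0

/-- A conformal Willmore immersion of a cylinder. -/
structure ConfWillmore (f : ℝ → ℝ → EuclideanSpace ℝ (Fin n)) (u : ℝ → ℝ → ℝ) (s : Set ℝ)
    extends ConfImm f u s : Prop where
  willmore : ∀ t ∈ s, ∀ θ : ℝ, willmoreOp f u t θ = 0

/-- The first residue `τ₁(f,c)(t)`. -/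
def tau1 (f : ℝ → ℝ → EuclideanSpace ℝ (Fin n)) (u : ℝ → ℝ → ℝ)
    (c : EuclideanSpace ℝ (Fin n)) (t : ℝ) : ℝ :=
  ⟪(-2 : ℝ) • (∫ θ in (0 : ℝ)..(2 * π), pt (Hmc f u) t θ)
    - (4 : ℝ) • (∫ θ in (0 : ℝ)..(2 * π), Real.exp (-(2 * u t θ)) •
        (⟪Hmc f u t θ, Att f u t θ⟫_ℝ • pt f t θ + ⟪Hmc f u t θ, Atth f u t θ⟫_ℝ • pth f t θ))
    + ∫ θ in (0 : ℝ)..(2 * π), ‖Hmc f u t θ‖ ^ 2 • pt f t θ, c⟫_ℝ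

/-- The second residue `τ₂(f,S)(t)`, for a matrix `S`. -/
def tau2 (f : ℝ → ℝ → EuclideanSpace ℝ (Fin n)) (u : ℝ → ℝ → ℝ)
    (S : Matrix (Fin n) (Fin n) ℝ) (t : ℝ) : ℝ :=
  2 * (∫ θ in (0 : ℝ)..(2 * π),
        (⟪Hmc f u t θ, pt (fun a b => (Matrix.toEuclideanLin S) (f a b)) t θ⟫_ℝ
          - ⟪pt (Hmc f u) t θ, (Matrix.toEuclideanLin S) (f t θ)⟫_ℝ))
  - 4 * (∫ θ in (0 : ℝ)..(2 * π), Real.exp (-(2 * u t θ)) *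
        (⟪Hmc f u t θ, Att f u t θ⟫_ℝ * ⟪pt f t θ, (Matrix.toEuclideanLin S) (f t θ)⟫_ℝ
          + ⟪Hmc f u t θ, Atth f u t θ⟫_ℝ * ⟪pth f t θ, (Matrix.toEuclideanLin S) (f t θ)⟫_ℝ))
  + ∫ θ in (0 : ℝ)..(2 * π), ‖Hmc f u t θ‖ ^ 2 * ⟪pt f t θ, (Matrix.toEuclideanLin S) (f t θ)⟫_ℝ

/-- Pointwise norm of the gradient of a scalar function on the cylinder. -/
def gradNorm (u : ℝ → ℝ → ℝ) (t θ : ℝ) : ℝ :=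
  Real.sqrt ((pt u t θ) ^ 2 + (pth u t θ) ^ 2)

/-- Integral of a density over the piece `[a,b] × S¹` of the cylinder. -/
def cylInt (F : ℝ → ℝ → ℝ) (a b : ℝ) : ℝ :=
  ∫ p in Set.Icc a b ×ˢ Set.Icc (0 : ℝ) (2 * π), F p.1 p.2

/-- The density `|A|² dV_g` (with respect to `dt dθ`). -/
def Adens (f : ℝ → ℝ → EuclideanSpace ℝ (Fin n)) (u : ℝ → ℝ → ℝ) : ℝ → ℝ → ℝ :=
  fun t θ => Asq f u t θ * Real.exp (2 * u t θ)

/-- The density `|H|² dV_g` (with respect to `dt dθ`). -/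
def Hdens (f : ℝ → ℝ → EuclideanSpace ℝ (Fin n)) (u : ℝ → ℝ → ℝ) : ℝ → ℝ → ℝ :=
  fun t θ => ‖Hmc f u t θ‖ ^ 2 * Real.exp (2 * u t θ)

/-- The open unit disk in `ℝ²`. -/
def unitDisk : Set (ℝ × ℝ) := {p : ℝ × ℝ | p.1 ^ 2 + p.2 ^ 2 < 1}

/-- The punctured open unit disk in `ℝ²`. -/
def puncturedDisk : Set (ℝ × ℝ) := {p : ℝ × ℝ | 0 < p.1 ^ 2 + p.2 ^ 2 ∧ p.1 ^ 2 + p.2 ^ 2 < 1}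

/-- A conformal Willmore immersion on a planar domain `s ⊆ ℝ²`, in Cartesian
coordinates `(x,y)`; here `pt`/`pth` are the partial derivatives `∂_x`/`∂_y`. -/
structure DiskConfWillmore (f : ℝ → ℝ → EuclideanSpace ℝ (Fin n)) (w : ℝ → ℝ → ℝ)
    (s : Set (ℝ × ℝ)) : Prop where
  smooth_f : ContDiffOn ℝ (⊤ : ℕ∞) (fun p : ℝ × ℝ => f p.1 p.2) s
  smooth_w : ContDiffOn ℝ (⊤ : ℕ∞) (fun p : ℝ × ℝ => w p.1 p.2) s
  conf_x : ∀ p ∈ s, ‖pt f p.1 p.2‖ ^ 2 = Real.exp (2 * w p.1 p.2)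
  conf_y : ∀ p ∈ s, ‖pth f p.1 p.2‖ ^ 2 = Real.exp (2 * w p.1 p.2)
  conf_orth : ∀ p ∈ s, ⟪pt f p.1 p.2, pth f p.1 p.2⟫_ℝ = 0
  willmore : ∀ p ∈ s, willmoreOp f w p.1 p.2 = 0

/-- The cylinder map `f̂(t,θ) = f(e^{-t} cos θ, e^{-t} sin θ)` associated to a disk map `f`. -/
def cylOf (f : ℝ → ℝ → EuclideanSpace ℝ (Fin n)) : ℝ → ℝ → EuclideanSpace ℝ (Fin n) :=
  fun t θ => f (Real.exp (-t) * Real.cos θ) (Real.exp (-t) * Real.sin θ)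

/-- The conformal factor of `f̂` in terms of the conformal factor `w` of the disk map. -/
def cylFactor (w : ℝ → ℝ → ℝ) : ℝ → ℝ → ℝ :=
  fun t θ => w (Real.exp (-t) * Real.cos θ) (Real.exp (-t) * Real.sin θ) - t

section PartialDerivatives

variable {F : Type*} [NormedAddCommGroup F] [NormedSpace ℝ F]

/-- Smoothness on the open unit disk of a function of two variables. -/
def DiskSmooth (g : ℝ → ℝ → F) : Prop :=
  ContDiffOn ℝ (⊤ : ℕ∞) (fun p : ℝ × ℝ => g p.1 p.2) unitDisk

lemma isOpen_unitDisk : IsOpen unitDisk :=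
  isOpen_lt (by fun_prop) continuous_const

lemma hasDerivAt_fderiv_fst {g : ℝ × ℝ → F} {p : ℝ × ℝ} (hg : DifferentiableAt ℝ g p) :
    HasDerivAt (fun s => g (s, p.2)) (fderiv ℝ g p (1, 0)) p.1 :=
  hg.hasFDerivAt.comp_hasDerivAt p.1 ((hasDerivAt_id p.1).prodMk (hasDerivAt_const p.1 p.2))

lemma hasDerivAt_fderiv_snd {g : ℝ × ℝ → F} {p : ℝ × ℝ} (hg : DifferentiableAt ℝ g p) :
    HasDerivAt (fun s => g (p.1, s)) (fderiv ℝ g p (0, 1)) p.2 :=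
  hg.hasFDerivAt.comp_hasDerivAt p.2 ((hasDerivAt_const p.2 p.1).prodMk (hasDerivAt_id p.2))

namespace DiskSmooth

variable {g : ℝ → ℝ → F}

lemma contDiffAt (hg : DiskSmooth g) {p : ℝ × ℝ} (hp : p ∈ unitDisk) :
    ContDiffAt ℝ (⊤ : ℕ∞) (fun p : ℝ × ℝ => g p.1 p.2) p :=
  ContDiffOn.contDiffAt hg (isOpen_unitDisk.mem_nhds hp)

lemma differentiableAt (hg : DiskSmooth g) {p : ℝ × ℝ} (hp : p ∈ unitDisk) :
    DifferentiableAt ℝ (fun p : ℝ × ℝ => g p.1 p.2) p :=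
  (hg.contDiffAt hp).differentiableAt (by simp)

lemma hasDerivAt_pt (hg : DiskSmooth g) {x y : ℝ} (hp : (x, y) ∈ unitDisk) :
    HasDerivAt (fun s => g s y) (pt g x y) x :=
  (hasDerivAt_fderiv_fst (hg.differentiableAt hp)).differentiableAt.hasDerivAt

lemma hasDerivAt_pth (hg : DiskSmooth g) {x y : ℝ} (hp : (x, y) ∈ unitDisk) :
    HasDerivAt (fun s => g x s) (pth g x y) y :=
  (hasDerivAt_fderiv_snd (hg.differentiableAt hp)).differentiableAt.hasDerivAt

lemma pt_eq (hg : DiskSmooth g) {p : ℝ × ℝ} (hp : p ∈ unitDisk) :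
    pt g p.1 p.2 = fderiv ℝ (fun p : ℝ × ℝ => g p.1 p.2) p (1, 0) :=
  (hasDerivAt_fderiv_fst (hg.differentiableAt hp)).deriv

lemma pth_eq (hg : DiskSmooth g) {p : ℝ × ℝ} (hp : p ∈ unitDisk) :
    pth g p.1 p.2 = fderiv ℝ (fun p : ℝ × ℝ => g p.1 p.2) p (0, 1) :=
  (hasDerivAt_fderiv_snd (hg.differentiableAt hp)).deriv

lemma contDiffOn_fderiv_apply (hg : DiskSmooth g) (v : ℝ × ℝ) :
    ContDiffOn ℝ (⊤ : ℕ∞) (fun p => fderiv ℝ (fun p : ℝ × ℝ => g p.1 p.2) p v) unitDisk :=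
  (ContDiffOn.fderiv_of_isOpen hg isOpen_unitDisk (by simp)).clm_apply contDiffOn_const

lemma pt (hg : DiskSmooth g) : DiskSmooth (pt g) :=
  (hg.contDiffOn_fderiv_apply (1, 0)).congr fun _ hp => hg.pt_eq hp

lemma pth (hg : DiskSmooth g) : DiskSmooth (pth g) :=
  (hg.contDiffOn_fderiv_apply (0, 1)).congr fun _ hp => hg.pth_eq hp

lemma pt_pth_comm (hg : DiskSmooth g) {x y : ℝ} (hp : (x, y) ∈ unitDisk) :
    _root_.pt (_root_.pth g) x y = _root_.pth (_root_.pt g) x y := by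
  have hdd : DifferentiableAt ℝ (fderiv ℝ (fun p : ℝ × ℝ => g p.1 p.2)) (x, y) :=
    ((hg.contDiffAt hp).fderiv_right (m := 1) (by norm_cast)).differentiableAt (by simp)
  have key (v : ℝ × ℝ) (h : ℝ × ℝ → F)
      (hh : ∀ p ∈ unitDisk, h p = fderiv ℝ (fun p : ℝ × ℝ => g p.1 p.2) p v) (u : ℝ × ℝ) :
      fderiv ℝ h (x, y) u = fderiv ℝ (fderiv ℝ (fun p : ℝ × ℝ => g p.1 p.2)) (x, y) u v := by
    have : h =ᶠ[nhds (x, y)] fun p => fderiv ℝ (fun p : ℝ × ℝ => g p.1 p.2) p v :=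
      Filter.eventuallyEq_of_mem (isOpen_unitDisk.mem_nhds hp) hh
    rw [this.fderiv_eq, fderiv_clm_apply hdd (by fun_prop)]
    simp
  rw [hg.pth.pt_eq (p := (x, y)) hp, hg.pt.pth_eq (p := (x, y)) hp,
    key (0, 1) _ (fun p hp => hg.pth_eq hp), key (1, 0) _ (fun p hp => hg.pt_eq hp)]
  exact (hg.contDiffAt hp).isSymmSndFDerivAt
    (by simpa using WithTop.coe_le_coe.2 (le_top : (2 : ℕ∞) ≤ ⊤)) _ _

/-- Chain rule along a planar curve. -/
lemma hasDerivAt_comp (hg : DiskSmooth g) {x y : ℝ → ℝ} {x' y' s : ℝ}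
    (hx : HasDerivAt x x' s) (hy : HasDerivAt y y' s) (hp : (x s, y s) ∈ unitDisk) :
    HasDerivAt (fun s => g (x s) (y s))
      (x' • _root_.pt g (x s) (y s) + y' • _root_.pth g (x s) (y s)) s := by
  have h := (hg.differentiableAt hp).hasFDerivAt.comp_hasDerivAt s (hx.prodMk hy)
  have e : ((x', y') : ℝ × ℝ) = x' • (1, 0) + y' • (0, 1) := by simp
  rw [e, map_add, map_smul, map_smul, ← hg.pt_eq hp, ← hg.pth_eq hp] at h
  exact h

section Operations

variable {f : ℝ → ℝ → F}

lemma add (hf : DiskSmooth f) (hg : DiskSmooth g) : DiskSmooth fun x y => f x y + g x y :=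
  ContDiffOn.add hf hg

lemma sub (hf : DiskSmooth f) (hg : DiskSmooth g) : DiskSmooth fun x y => f x y - g x y :=
  ContDiffOn.sub hf hg

lemma smul {a : ℝ → ℝ → ℝ} (ha : DiskSmooth a) (hg : DiskSmooth g) :
    DiskSmooth fun x y => a x y • g x y :=
  ContDiffOn.smul ha hg

lemma const_smul (hg : DiskSmooth g) (c : ℝ) : DiskSmooth fun x y => c • g x y :=
  ContDiffOn.const_smul c hg

lemma clm {G : Type*} [NormedAddCommGroup G] [NormedSpace ℝ G] (hg : DiskSmooth g)
    (L : F →L[ℝ] G) : DiskSmooth fun x y => L (g x y) :=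
  L.contDiff.comp_contDiffOn hg

lemma exp_neg_two_mul {w : ℝ → ℝ → ℝ} (hw : DiskSmooth w) :
    DiskSmooth fun x y => Real.exp (-(2 * w x y)) :=
  ((contDiffOn_const.mul hw).neg).exp

end Operations

end DiskSmooth

end PartialDerivatives

namespace DiskSmooth

variable {E : Type*} [NormedAddCommGroup E] [InnerProductSpace ℝ E] {f g : ℝ → ℝ → E}

lemma inner (hf : DiskSmooth f) (hg : DiskSmooth g) : DiskSmooth fun x y => ⟪f x y, g x y⟫_ℝ :=
  ContDiffOn.inner ℝ hf hg

lemma norm_sq (hf : DiskSmooth f) : DiskSmooth fun x y => ‖f x y‖ ^ 2 :=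
  ContDiffOn.norm_sq ℝ hf

end DiskSmooth

section Polar

variable {F : Type*} [NormedAddCommGroup F] [NormedSpace ℝ F]

/-- The first Cartesian coordinate of the point with cylinder coordinates `(t, θ)`. -/
def polarX (t θ : ℝ) : ℝ := Real.exp (-t) * Real.cos θ

/-- The second Cartesian coordinate of the point with cylinder coordinates `(t, θ)`. -/
def polarY (t θ : ℝ) : ℝ := Real.exp (-t) * Real.sin θ

/-- The pullback to the cylinder of a function on the disk. -/
def polar (g : ℝ → ℝ → F) (t θ : ℝ) : F := g (polarX t θ) (polarY t θ)

lemma polarX_sq_add_polarY_sq (t θ : ℝ) :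
    polarX t θ ^ 2 + polarY t θ ^ 2 = Real.exp (-(2 * t)) := by
  have : Real.exp (-(2 * t)) = Real.exp (-t) ^ 2 := by rw [← Real.exp_nat_mul]; ring_nf
  rw [this, polarX, polarY]
  linear_combination Real.exp (-t) ^ 2 * Real.sin_sq_add_cos_sq θ

lemma polar_mem {t : ℝ} (ht : 0 < t) (θ : ℝ) : (polarX t θ, polarY t θ) ∈ unitDisk := by
  change polarX t θ ^ 2 + polarY t θ ^ 2 < 1
  rw [polarX_sq_add_polarY_sq, Real.exp_lt_one_iff]
  linarith

lemma hasDerivAt_polarX_t (t θ : ℝ) : HasDerivAt (fun s => polarX s θ) (-polarX t θ) t := by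
  have := ((hasDerivAt_id t).neg.exp).mul_const (Real.cos θ)
  simpa [polarX] using this

lemma hasDerivAt_polarY_t (t θ : ℝ) : HasDerivAt (fun s => polarY s θ) (-polarY t θ) t := by
  have := ((hasDerivAt_id t).neg.exp).mul_const (Real.sin θ)
  simpa [polarY] using this

lemma hasDerivAt_polarX_th (t θ : ℝ) : HasDerivAt (fun s => polarX t s) (-polarY t θ) θ := by
  have := (Real.hasDerivAt_cos θ).const_mul (Real.exp (-t))
  simpa [polarX, polarY] using this

lemma hasDerivAt_polarY_th (t θ : ℝ) : HasDerivAt (fun s => polarY t s) (polarX t θ) θ :=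
  (Real.hasDerivAt_sin θ).const_mul (Real.exp (-t))

lemma DiskSmooth.hasDerivAt_polar_t {g : ℝ → ℝ → F} (hg : DiskSmooth g) {t : ℝ} (ht : 0 < t)
    (θ : ℝ) : HasDerivAt (fun s => polar g s θ)
      (-(polarX t θ • polar (_root_.pt g) t θ + polarY t θ • polar (_root_.pth g) t θ)) t := by
  refine (hg.hasDerivAt_comp (hasDerivAt_polarX_t t θ) (hasDerivAt_polarY_t t θ)
    (polar_mem ht θ)).congr_deriv ?_
  simp only [polar]
  module

lemma DiskSmooth.hasDerivAt_polar_th {g : ℝ → ℝ → F} (hg : DiskSmooth g) {t : ℝ} (ht : 0 < t)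
    (θ : ℝ) : HasDerivAt (fun s => polar g t s)
      (-(polarY t θ • polar (_root_.pt g) t θ) + polarX t θ • polar (_root_.pth g) t θ) θ := by
  refine (hg.hasDerivAt_comp (hasDerivAt_polarX_th t θ) (hasDerivAt_polarY_th t θ)
    (polar_mem ht θ)).congr_deriv ?_
  simp only [polar]
  module

lemma DiskSmooth.pt_polar {g : ℝ → ℝ → F} (hg : DiskSmooth g) {t : ℝ} (ht : 0 < t) (θ : ℝ) :
    _root_.pt (polar g) t θ =
      -(polarX t θ • polar (_root_.pt g) t θ + polarY t θ • polar (_root_.pth g) t θ) :=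
  (hg.hasDerivAt_polar_t ht θ).deriv

lemma DiskSmooth.pth_polar {g : ℝ → ℝ → F} (hg : DiskSmooth g) {t : ℝ} (ht : 0 < t) (θ : ℝ) :
    _root_.pth (polar g) t θ =
      -(polarY t θ • polar (_root_.pt g) t θ) + polarX t θ • polar (_root_.pth g) t θ :=
  (hg.hasDerivAt_polar_th ht θ).deriv

lemma pt_congr {f g : ℝ → ℝ → F} (h : ∀ t, 0 < t → ∀ θ, f t θ = g t θ) {t : ℝ} (ht : 0 < t)
    (θ : ℝ) : pt f t θ = pt g t θ :=
  Filter.EventuallyEq.deriv_eq <|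
    Filter.eventuallyEq_of_mem (Ioi_mem_nhds ht) fun s hs => h s hs θ

lemma pth_congr {f g : ℝ → ℝ → F} (h : ∀ t, 0 < t → ∀ θ, f t θ = g t θ) {t : ℝ} (ht : 0 < t)
    (θ : ℝ) : pth f t θ = pth g t θ :=
  congrArg (fun k => deriv k θ) (funext fun s => h t ht s)

/-- The divergence of a pulled-back covector field. -/
lemma div_polar {U V : ℝ → ℝ → F} (hU : DiskSmooth U) (hV : DiskSmooth V) {P Q : ℝ → ℝ → F}
    (hP : ∀ t, 0 < t → ∀ θ, P t θ = -(polarX t θ • polar U t θ + polarY t θ • polar V t θ))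
    (hQ : ∀ t, 0 < t → ∀ θ, Q t θ = -(polarY t θ • polar U t θ) + polarX t θ • polar V t θ)
    {t : ℝ} (ht : 0 < t) (θ : ℝ) :
    pt P t θ + pth Q t θ =
      Real.exp (-(2 * t)) • (polar (pt U) t θ + polar (pth V) t θ) := by
  have h1 := (((hasDerivAt_polarX_t t θ).smul (hU.hasDerivAt_polar_t ht θ)).add
    ((hasDerivAt_polarY_t t θ).smul (hV.hasDerivAt_polar_t ht θ))).neg
  have h2 := ((hasDerivAt_polarY_th t θ).smul (hU.hasDerivAt_polar_th ht θ)).neg.add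
    ((hasDerivAt_polarX_th t θ).smul (hV.hasDerivAt_polar_th ht θ))
  rw [pt_congr hP ht, pth_congr hQ ht, ← polarX_sq_add_polarY_sq t θ]
  refine (congrArg₂ (· + ·) h1.deriv h2.deriv).trans ?_
  module

/-- The second-order chain rule for `∂_t²`. -/
lemma pt_pt_polar {g : ℝ → ℝ → F} (hg : DiskSmooth g) {t : ℝ} (ht : 0 < t) (θ : ℝ) :
    pt (pt (polar g)) t θ = polarX t θ • polar (pt g) t θ + polarY t θ • polar (pth g) t θ
      + polarX t θ ^ 2 • polar (pt (pt g)) t θ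
      + (2 * polarX t θ * polarY t θ) • polar (pt (pth g)) t θ
      + polarY t θ ^ 2 • polar (pth (pth g)) t θ := by
  have h := (((hasDerivAt_polarX_t t θ).smul (hg.pt.hasDerivAt_polar_t ht θ)).add
    ((hasDerivAt_polarY_t t θ).smul (hg.pth.hasDerivAt_polar_t ht θ))).neg
  rw [pt_congr (fun t ht θ => hg.pt_polar ht θ) ht]
  refine h.deriv.trans ?_
  have hc : polar (pth (pt g)) t θ = polar (pt (pth g)) t θ :=
    (hg.pt_pth_comm (polar_mem ht θ)).symm
  rw [hc]
  module

/-- The second-order chain rule for `∂_t∂_θ`. -/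
lemma pt_pth_polar {g : ℝ → ℝ → F} (hg : DiskSmooth g) {t : ℝ} (ht : 0 < t) (θ : ℝ) :
    pt (pth (polar g)) t θ = polarY t θ • polar (pt g) t θ - polarX t θ • polar (pth g) t θ
      + (polarX t θ * polarY t θ) • (polar (pt (pt g)) t θ - polar (pth (pth g)) t θ)
      + (polarY t θ ^ 2 - polarX t θ ^ 2) • polar (pt (pth g)) t θ := by
  have h := ((hasDerivAt_polarY_t t θ).smul (hg.pt.hasDerivAt_polar_t ht θ)).neg.add
    ((hasDerivAt_polarX_t t θ).smul (hg.pth.hasDerivAt_polar_t ht θ))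
  rw [pt_congr (fun t ht θ => hg.pth_polar ht θ) ht]
  refine h.deriv.trans ?_
  have hc : polar (pth (pt g)) t θ = polar (pt (pth g)) t θ :=
    (hg.pt_pth_comm (polar_mem ht θ)).symm
  rw [hc]
  module

/-- The second-order chain rule for `∂_θ²`. -/
lemma pth_pth_polar {g : ℝ → ℝ → F} (hg : DiskSmooth g) {t : ℝ} (ht : 0 < t) (θ : ℝ) :
    pth (pth (polar g)) t θ = -(polarX t θ • polar (pt g) t θ + polarY t θ • polar (pth g) t θ)
      + polarY t θ ^ 2 • polar (pt (pt g)) t θ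
      - (2 * polarX t θ * polarY t θ) • polar (pt (pth g)) t θ
      + polarX t θ ^ 2 • polar (pth (pth g)) t θ := by
  have h := ((hasDerivAt_polarY_th t θ).smul (hg.pt.hasDerivAt_polar_th ht θ)).neg.add
    ((hasDerivAt_polarX_th t θ).smul (hg.pth.hasDerivAt_polar_th ht θ))
  rw [pth_congr (fun t ht θ => hg.pth_polar ht θ) ht]
  refine h.deriv.trans ?_
  have hc : polar (pth (pt g)) t θ = polar (pt (pth g)) t θ :=
    (hg.pt_pth_comm (polar_mem ht θ)).symm
  rw [hc]
  module

end Polar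

section Flux

variable {F : Type*} [NormedAddCommGroup F] [NormedSpace ℝ F]

lemma continuous_polarX (t : ℝ) : Continuous (polarX t) := by
  unfold polarX
  fun_prop

lemma continuous_polarY (t : ℝ) : Continuous (polarY t) := by
  unfold polarY
  fun_prop

lemma DiskSmooth.continuous_polar {g : ℝ → ℝ → F} (hg : DiskSmooth g) {t : ℝ} (ht : 0 < t) :
    Continuous (polar g t) :=
  (ContDiffOn.continuousOn hg).comp_continuous
    ((continuous_polarX t).prodMk (continuous_polarY t)) fun θ => polar_mem ht θ

/-- The flux of a divergence-free field through a circle vanishes. -/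
lemma integral_flux_eq_zero {U V : ℝ → ℝ → F} (hU : DiskSmooth U) (hV : DiskSmooth V)
    (hdiv : ∀ x y, (x, y) ∈ unitDisk → pt U x y + pth V x y = 0) {t : ℝ} (ht : 0 < t) :
    ∫ θ in (0 : ℝ)..(2 * π), (polarX t θ • polar U t θ + polarY t θ • polar V t θ) = 0 := by
  set R := Real.exp (-t) with hR
  have hR0 : 0 < R := Real.exp_pos _
  have hR1 : R < 1 := Real.exp_lt_one_iff.2 (by linarith)
  let A : ℝ × ℝ → F := fun p => U (p.1 * Real.cos p.2) (p.1 * Real.sin p.2)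
  let B : ℝ × ℝ → F := fun p => V (p.1 * Real.cos p.2) (p.1 * Real.sin p.2)
  let P : ℝ × ℝ → F := fun p => p.1 • (Real.cos p.2 • A p + Real.sin p.2 • B p)
  let Q : ℝ × ℝ → F := fun p => -(Real.sin p.2 • A p) + Real.cos p.2 • B p
  have hmem : ∀ p : ℝ × ℝ, p.1 ∈ Set.uIcc 0 R →
      (p.1 * Real.cos p.2, p.1 * Real.sin p.2) ∈ unitDisk := by
    intro p hp
    rw [Set.uIcc_of_le hR0.le] at hp
    change (p.1 * Real.cos p.2) ^ 2 + (p.1 * Real.sin p.2) ^ 2 < 1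
    have : (p.1 * Real.cos p.2) ^ 2 + (p.1 * Real.sin p.2) ^ 2 = p.1 ^ 2 := by
      linear_combination p.1 ^ 2 * Real.sin_sq_add_cos_sq p.2
    rw [this]
    nlinarith [hp.1, hp.2]
  have hcomp : ∀ {g : ℝ → ℝ → F}, DiskSmooth g → ∀ p : ℝ × ℝ, p.1 ∈ Set.uIcc 0 R →
      DifferentiableAt ℝ (fun p : ℝ × ℝ => g (p.1 * Real.cos p.2) (p.1 * Real.sin p.2)) p := by
    intro g hg p hp
    exact (hg.differentiableAt (hmem p hp)).comp p
      (f := fun p : ℝ × ℝ => (p.1 * Real.cos p.2, p.1 * Real.sin p.2)) (by fun_prop)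
  have hP : ∀ p : ℝ × ℝ, p.1 ∈ Set.uIcc 0 R → DifferentiableAt ℝ P p := by
    intro p hp
    have hA : DifferentiableAt ℝ A p := hcomp hU p hp
    have hB : DifferentiableAt ℝ B p := hcomp hV p hp
    fun_prop
  have hQ : ∀ p : ℝ × ℝ, p.1 ∈ Set.uIcc 0 R → DifferentiableAt ℝ Q p := by
    intro p hp
    have hA : DifferentiableAt ℝ A p := hcomp hU p hp
    have hB : DifferentiableAt ℝ B p := hcomp hV p hp
    fun_prop
  have hzero : ∀ p : ℝ × ℝ, p.1 ∈ Set.uIcc 0 R →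
      fderiv ℝ P p (1, 0) + fderiv ℝ Q p (0, 1) = 0 := by
    rintro ⟨r, θ⟩ hp
    have hm := hmem _ hp
    have hx : HasDerivAt (fun s => s * Real.cos θ) (Real.cos θ) r := by
      simpa using (hasDerivAt_id r).mul_const (Real.cos θ)
    have hy : HasDerivAt (fun s => s * Real.sin θ) (Real.sin θ) r := by
      simpa using (hasDerivAt_id r).mul_const (Real.sin θ)
    have hx' := (Real.hasDerivAt_cos θ).const_mul r
    have hy' := (Real.hasDerivAt_sin θ).const_mul r
    have e1 := (hasDerivAt_fderiv_fst (hP _ hp)).unique <| (hasDerivAt_id r).smul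
      (((hU.hasDerivAt_comp hx hy hm).const_smul (Real.cos θ)).add
        ((hV.hasDerivAt_comp hx hy hm).const_smul (Real.sin θ)))
    have e2 := (hasDerivAt_fderiv_snd (hQ _ hp)).unique <|
      ((Real.hasDerivAt_sin θ).smul (hU.hasDerivAt_comp hx' hy' hm)).neg.add
        ((Real.hasDerivAt_cos θ).smul (hV.hasDerivAt_comp hx' hy' hm))
    rw [e1, e2]
    refine Eq.trans ?_ (smul_zero (r * (Real.sin θ ^ 2 + Real.cos θ ^ 2)))
    rw [← hdiv _ _ hm]
    simp only [id]
    module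
  have key := integral2_divergence_prod_of_hasFDerivAt P Q (fderiv ℝ P) (fderiv ℝ Q)
    0 0 R (2 * π) (fun p hp => (hP p hp.1).continuousAt.continuousWithinAt)
    (fun p hp => (hQ p hp.1).continuousAt.continuousWithinAt)
    (fun p hp => (hP p (Set.Ioo_subset_Icc_self hp.1)).hasFDerivAt)
    (fun p hp => (hQ p (Set.Ioo_subset_Icc_self hp.1)).hasFDerivAt)
    (integrableOn_zero.congr_fun (fun p hp => (hzero p hp.1).symm)
      (measurableSet_uIcc.prod measurableSet_uIcc))
  have hlhs : (∫ x in (0 : ℝ)..R, ∫ y in (0 : ℝ)..(2 * π),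
      fderiv ℝ P (x, y) (1, 0) + fderiv ℝ Q (x, y) (0, 1)) = 0 := by
    rw [intervalIntegral.integral_congr (g := fun _ => (0 : F)) fun x hx => ?_]
    · simp
    · simp [fun y => hzero (x, y) hx]
  rw [hlhs] at key
  simp only [Q, P, A, B, Real.cos_two_pi, Real.sin_two_pi, Real.cos_zero, Real.sin_zero, zero_smul,
    intervalIntegral.integral_zero, sub_self, zero_add, sub_zero] at key
  refine Eq.trans ?_ key.symm
  refine intervalIntegral.integral_congr fun θ _ => ?_
  simp only [polar, polarX, polarY, ← hR, smul_add, smul_smul]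

/-- A combination of fluxes with vanishing total divergence vanishes. -/
lemma flux_combination_eq_zero {U₁ V₁ U₂ V₂ U₃ V₃ : ℝ → ℝ → F} (hU₁ : DiskSmooth U₁)
    (hV₁ : DiskSmooth V₁) (hU₂ : DiskSmooth U₂) (hV₂ : DiskSmooth V₂) (hU₃ : DiskSmooth U₃)
    (hV₃ : DiskSmooth V₃) (a b : ℝ) {t : ℝ} (ht : 0 < t) {A B C : ℝ → F}
    (hA : ∀ θ, A θ = -(polarX t θ • polar U₁ t θ + polarY t θ • polar V₁ t θ))
    (hB : ∀ θ, B θ = -(polarX t θ • polar U₂ t θ + polarY t θ • polar V₂ t θ))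
    (hC : ∀ θ, C θ = -(polarX t θ • polar U₃ t θ + polarY t θ • polar V₃ t θ))
    (hdiv : ∀ x y, (x, y) ∈ unitDisk → a • (pt U₁ x y + pth V₁ x y)
      - b • (pt U₂ x y + pth V₂ x y) + (pt U₃ x y + pth V₃ x y) = 0) :
    a • (∫ θ in (0 : ℝ)..(2 * π), A θ) - b • (∫ θ in (0 : ℝ)..(2 * π), B θ)
      + ∫ θ in (0 : ℝ)..(2 * π), C θ = 0 := by
  have hint : ∀ {U V : ℝ → ℝ → F} {G : ℝ → F}, DiskSmooth U → DiskSmooth V →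
      (∀ θ, G θ = -(polarX t θ • polar U t θ + polarY t θ • polar V t θ)) →
      IntervalIntegrable G volume 0 (2 * π) := by
    intro U V G hU hV hG
    rw [funext hG]
    exact ((((continuous_polarX t).smul (hU.continuous_polar ht)).add
      ((continuous_polarY t).smul (hV.continuous_polar ht))).neg).intervalIntegrable _ _
  have iA := hint hU₁ hV₁ hA
  have iB := hint hU₂ hV₂ hB
  have iC := hint hU₃ hV₃ hC
  have hU := ((hU₁.const_smul a).sub (hU₂.const_smul b)).add hU₃
  have hV := ((hV₁.const_smul a).sub (hV₂.const_smul b)).add hV₃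
  have h0 := integral_flux_eq_zero hU hV (fun x y hp => by
    have e1 : pt (fun x y => a • U₁ x y - b • U₂ x y + U₃ x y) x y = _ :=
      ((((hU₁.hasDerivAt_pt hp).const_smul a).sub ((hU₂.hasDerivAt_pt hp).const_smul b)).add
        (hU₃.hasDerivAt_pt hp)).deriv
    have e2 : pth (fun x y => a • V₁ x y - b • V₂ x y + V₃ x y) x y = _ :=
      ((((hV₁.hasDerivAt_pth hp).const_smul a).sub ((hV₂.hasDerivAt_pth hp).const_smul b)).add
        (hV₃.hasDerivAt_pth hp)).deriv
    rw [e1, e2, ← hdiv x y hp]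
    module) ht
  have jA : IntervalIntegrable (fun θ => a • A θ) volume 0 (2 * π) := iA.smul a
  have jB : IntervalIntegrable (fun θ => b • B θ) volume 0 (2 * π) := iB.smul b
  rw [← intervalIntegral.integral_smul, ← intervalIntegral.integral_smul,
    ← intervalIntegral.integral_sub jA jB, ← intervalIntegral.integral_add (jA.sub jB) iC,
    ← neg_eq_zero,
    ← intervalIntegral.integral_neg, ← h0]
  refine intervalIntegral.integral_congr fun θ _ => ?_
  simp only [hA, hB, hC, polar]
  module

end Flux

section Willmore

variable {f : ℝ → ℝ → EuclideanSpace ℝ (Fin n)} {w : ℝ → ℝ → ℝ}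

/-- The `t`-component of the field `e^{-2u} ⟨H, A_{ij}⟩ ∂_j f`. -/
def shapeT (f : ℝ → ℝ → EuclideanSpace ℝ (Fin n)) (u : ℝ → ℝ → ℝ) :
    ℝ → ℝ → EuclideanSpace ℝ (Fin n) :=
  fun a b => Real.exp (-(2 * u a b)) •
    (⟪Hmc f u a b, Att f u a b⟫_ℝ • pt f a b + ⟪Hmc f u a b, Atth f u a b⟫_ℝ • pth f a b)

/-- The `θ`-component of the field `e^{-2u} ⟨H, A_{ij}⟩ ∂_j f`. -/
def shapeTh (f : ℝ → ℝ → EuclideanSpace ℝ (Fin n)) (u : ℝ → ℝ → ℝ) :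
    ℝ → ℝ → EuclideanSpace ℝ (Fin n) :=
  fun a b => Real.exp (-(2 * u a b)) •
    (⟪Hmc f u a b, Atth f u a b⟫_ℝ • pt f a b + ⟪Hmc f u a b, Athth f u a b⟫_ℝ • pth f a b)

/-- The `t`-component of the field `|H|² ∂_i f`. -/
def energyT (f : ℝ → ℝ → EuclideanSpace ℝ (Fin n)) (u : ℝ → ℝ → ℝ) :
    ℝ → ℝ → EuclideanSpace ℝ (Fin n) :=
  fun a b => ‖Hmc f u a b‖ ^ 2 • pt f a b

/-- The `θ`-component of the field `|H|² ∂_i f`. -/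
def energyTh (f : ℝ → ℝ → EuclideanSpace ℝ (Fin n)) (u : ℝ → ℝ → ℝ) :
    ℝ → ℝ → EuclideanSpace ℝ (Fin n) :=
  fun a b => ‖Hmc f u a b‖ ^ 2 • pth f a b

lemma willmoreOp_eq (f : ℝ → ℝ → EuclideanSpace ℝ (Fin n)) (u : ℝ → ℝ → ℝ) (t θ : ℝ) :
    willmoreOp f u t θ = (2 : ℝ) • (pt (pt (Hmc f u)) t θ + pth (pth (Hmc f u)) t θ)
      + (4 : ℝ) • (pt (shapeT f u) t θ + pth (shapeTh f u) t θ)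
      - (pt (energyT f u) t θ + pth (energyTh f u) t θ) := by
  unfold willmoreOp shapeT shapeTh energyT energyTh
  module

lemma DiskSmooth.Hmc (hf : DiskSmooth f) (hw : DiskSmooth w) : DiskSmooth (Hmc f w) :=
  hw.exp_neg_two_mul.smul (hf.pt.pt.add hf.pth.pth)

lemma DiskSmooth.Att (hf : DiskSmooth f) (hw : DiskSmooth w) : DiskSmooth (Att f w) :=
  (hf.pt.pt.sub (hw.pt.smul hf.pt)).add (hw.pth.smul hf.pth)

lemma DiskSmooth.Atth (hf : DiskSmooth f) (hw : DiskSmooth w) : DiskSmooth (Atth f w) :=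
  (hf.pth.pt.sub (hw.pth.smul hf.pt)).sub (hw.pt.smul hf.pth)

lemma DiskSmooth.Athth (hf : DiskSmooth f) (hw : DiskSmooth w) : DiskSmooth (Athth f w) :=
  (hf.pth.pth.add (hw.pt.smul hf.pt)).sub (hw.pth.smul hf.pth)

lemma DiskSmooth.shapeT (hf : DiskSmooth f) (hw : DiskSmooth w) : DiskSmooth (shapeT f w) :=
  hw.exp_neg_two_mul.smul ((((hf.Hmc hw).inner (hf.Att hw)).smul hf.pt).add
    (((hf.Hmc hw).inner (hf.Atth hw)).smul hf.pth))

lemma DiskSmooth.shapeTh (hf : DiskSmooth f) (hw : DiskSmooth w) : DiskSmooth (shapeTh f w) :=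
  hw.exp_neg_two_mul.smul ((((hf.Hmc hw).inner (hf.Atth hw)).smul hf.pt).add
    (((hf.Hmc hw).inner (hf.Athth hw)).smul hf.pth))

lemma DiskSmooth.energyT (hf : DiskSmooth f) (hw : DiskSmooth w) : DiskSmooth (energyT f w) :=
  (hf.Hmc hw).norm_sq.smul hf.pt

lemma DiskSmooth.energyTh (hf : DiskSmooth f) (hw : DiskSmooth w) : DiskSmooth (energyTh f w) :=
  (hf.Hmc hw).norm_sq.smul hf.pth

lemma cylOf_eq_polar (f : ℝ → ℝ → EuclideanSpace ℝ (Fin n)) : cylOf f = polar f := rfl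

lemma pt_cylFactor (hw : DiskSmooth w) {t : ℝ} (ht : 0 < t) (θ : ℝ) :
    pt (cylFactor w) t θ =
      -(polarX t θ * polar (pt w) t θ + polarY t θ * polar (pth w) t θ) - 1 :=
  ((hw.hasDerivAt_polar_t ht θ).sub (hasDerivAt_id t)).deriv

lemma pth_cylFactor (hw : DiskSmooth w) {t : ℝ} (ht : 0 < t) (θ : ℝ) :
    pth (cylFactor w) t θ =
      -(polarY t θ * polar (pt w) t θ) + polarX t θ * polar (pth w) t θ :=
  ((hw.hasDerivAt_polar_th ht θ).sub_const t).deriv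

lemma exp_neg_cylFactor (w : ℝ → ℝ → ℝ) (t θ : ℝ) :
    Real.exp (-(2 * cylFactor w t θ)) = Real.exp (2 * t) * Real.exp (-(2 * polar w t θ)) := by
  rw [← Real.exp_add]
  congr 1
  simp only [cylFactor, polar, polarX, polarY]
  ring

lemma exp_mul_polar_sq (t θ : ℝ) :
    Real.exp (2 * t) * (polarX t θ ^ 2 + polarY t θ ^ 2) = 1 := by
  rw [polarX_sq_add_polarY_sq, ← Real.exp_add]
  simp

lemma Hmc_cyl (hf : DiskSmooth f) {t : ℝ} (ht : 0 < t) (θ : ℝ) :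
    Hmc (cylOf f) (cylFactor w) t θ = polar (Hmc f w) t θ := by
  rw [cylOf_eq_polar, Hmc, exp_neg_cylFactor, pt_pt_polar hf ht, pth_pth_polar hf ht]
  refine Eq.trans ?_ (one_smul ℝ _)
  rw [← exp_mul_polar_sq t θ]
  simp only [polar, Hmc]
  module

lemma Att_cyl (hf : DiskSmooth f) (hw : DiskSmooth w) {t : ℝ} (ht : 0 < t) (θ : ℝ) :
    Att (cylOf f) (cylFactor w) t θ = polarX t θ ^ 2 • polar (Att f w) t θ
      + (2 * polarX t θ * polarY t θ) • polar (Atth f w) t θ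
      + polarY t θ ^ 2 • polar (Athth f w) t θ := by
  rw [cylOf_eq_polar, Att, pt_pt_polar hf ht, pt_cylFactor hw ht, pth_cylFactor hw ht,
    hf.pt_polar ht, hf.pth_polar ht]
  simp only [polar, Att, Atth, Athth]
  module

lemma Atth_cyl (hf : DiskSmooth f) (hw : DiskSmooth w) {t : ℝ} (ht : 0 < t) (θ : ℝ) :
    Atth (cylOf f) (cylFactor w) t θ =
      (polarX t θ * polarY t θ) • (polar (Att f w) t θ - polar (Athth f w) t θ)
      + (polarY t θ ^ 2 - polarX t θ ^ 2) • polar (Atth f w) t θ := by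
  rw [cylOf_eq_polar, Atth, pt_pth_polar hf ht, pt_cylFactor hw ht, pth_cylFactor hw ht,
    hf.pt_polar ht, hf.pth_polar ht]
  simp only [polar, Att, Atth, Athth]
  module

lemma Athth_cyl (hf : DiskSmooth f) (hw : DiskSmooth w) {t : ℝ} (ht : 0 < t) (θ : ℝ) :
    Athth (cylOf f) (cylFactor w) t θ = polarY t θ ^ 2 • polar (Att f w) t θ
      - (2 * polarX t θ * polarY t θ) • polar (Atth f w) t θ
      + polarX t θ ^ 2 • polar (Athth f w) t θ := by
  rw [cylOf_eq_polar, Athth, pth_pth_polar hf ht, pt_cylFactor hw ht, pth_cylFactor hw ht,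
    hf.pt_polar ht, hf.pth_polar ht]
  simp only [polar, Att, Atth, Athth]
  module

lemma pt_Hmc_cyl (hf : DiskSmooth f) (hw : DiskSmooth w) {t : ℝ} (ht : 0 < t) (θ : ℝ) :
    pt (Hmc (cylOf f) (cylFactor w)) t θ =
      -(polarX t θ • polar (pt (Hmc f w)) t θ + polarY t θ • polar (pth (Hmc f w)) t θ) := by
  rw [pt_congr (fun t ht θ => Hmc_cyl hf ht θ) ht]
  exact (hf.Hmc hw).pt_polar ht θ

lemma pth_Hmc_cyl (hf : DiskSmooth f) (hw : DiskSmooth w) {t : ℝ} (ht : 0 < t) (θ : ℝ) :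
    pth (Hmc (cylOf f) (cylFactor w)) t θ =
      -(polarY t θ • polar (pt (Hmc f w)) t θ) + polarX t θ • polar (pth (Hmc f w)) t θ := by
  rw [pth_congr (fun t ht θ => Hmc_cyl hf ht θ) ht]
  exact (hf.Hmc hw).pth_polar ht θ

lemma shapeT_cyl (hf : DiskSmooth f) (hw : DiskSmooth w) {t : ℝ} (ht : 0 < t) (θ : ℝ) :
    shapeT (cylOf f) (cylFactor w) t θ =
      -(polarX t θ • polar (shapeT f w) t θ + polarY t θ • polar (shapeTh f w) t θ) := by
  rw [shapeT, Hmc_cyl hf ht, Att_cyl hf hw ht, Atth_cyl hf hw ht, exp_neg_cylFactor,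
    cylOf_eq_polar, hf.pt_polar ht, hf.pth_polar ht]
  refine Eq.trans ?_ (one_smul ℝ _)
  rw [← exp_mul_polar_sq t θ]
  simp only [polar, shapeT, shapeTh, inner_add_right, inner_sub_right, real_inner_smul_right]
  module

lemma shapeTh_cyl (hf : DiskSmooth f) (hw : DiskSmooth w) {t : ℝ} (ht : 0 < t) (θ : ℝ) :
    shapeTh (cylOf f) (cylFactor w) t θ =
      -(polarY t θ • polar (shapeT f w) t θ) + polarX t θ • polar (shapeTh f w) t θ := by
  rw [shapeTh, Hmc_cyl hf ht, Athth_cyl hf hw ht, Atth_cyl hf hw ht, exp_neg_cylFactor,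
    cylOf_eq_polar, hf.pt_polar ht, hf.pth_polar ht]
  refine Eq.trans ?_ (one_smul ℝ _)
  rw [← exp_mul_polar_sq t θ]
  simp only [polar, shapeT, shapeTh, inner_add_right, inner_sub_right, real_inner_smul_right]
  module

lemma energyT_cyl (hf : DiskSmooth f) {t : ℝ} (ht : 0 < t) (θ : ℝ) :
    energyT (cylOf f) (cylFactor w) t θ =
      -(polarX t θ • polar (energyT f w) t θ + polarY t θ • polar (energyTh f w) t θ) := by
  rw [energyT, Hmc_cyl hf ht, cylOf_eq_polar, hf.pt_polar ht]
  simp only [polar, energyT, energyTh]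
  module

lemma energyTh_cyl (hf : DiskSmooth f) {t : ℝ} (ht : 0 < t) (θ : ℝ) :
    energyTh (cylOf f) (cylFactor w) t θ =
      -(polarY t θ • polar (energyT f w) t θ) + polarX t θ • polar (energyTh f w) t θ := by
  rw [energyTh, Hmc_cyl hf ht, cylOf_eq_polar, hf.pth_polar ht]
  simp only [polar, energyT, energyTh]
  module

/-- Conformal covariance of the Willmore operator. -/
lemma willmoreOp_cyl (hf : DiskSmooth f) (hw : DiskSmooth w) {t : ℝ} (ht : 0 < t) (θ : ℝ) :
    willmoreOp (cylOf f) (cylFactor w) t θ =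
      Real.exp (-(2 * t)) • polar (willmoreOp f w) t θ := by
  rw [willmoreOp_eq, polar, willmoreOp_eq,
    div_polar (hf.Hmc hw).pt (hf.Hmc hw).pth (fun t ht θ => pt_Hmc_cyl hf hw ht θ)
      (fun t ht θ => pth_Hmc_cyl hf hw ht θ) ht,
    div_polar (hf.shapeT hw) (hf.shapeTh hw) (fun t ht θ => shapeT_cyl hf hw ht θ)
      (fun t ht θ => shapeTh_cyl hf hw ht θ) ht,
    div_polar (hf.energyT hw) (hf.energyTh hw) (fun t ht θ => energyT_cyl hf ht θ)
      (fun t ht θ => energyTh_cyl hf ht θ) ht]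
  simp only [polar]
  module

lemma exp_two_mul_cylFactor (w : ℝ → ℝ → ℝ) (t θ : ℝ) :
    Real.exp (2 * cylFactor w t θ) =
      (polarX t θ ^ 2 + polarY t θ ^ 2) * polar (fun x y => Real.exp (2 * w x y)) t θ := by
  rw [polarX_sq_add_polarY_sq, polar, ← Real.exp_add]
  congr 1
  simp only [cylFactor, polarX, polarY]
  ring

/-- The cylinder map of a conformal disk map is conformal. -/
lemma DiskConfWillmore.conformal_cyl (h : DiskConfWillmore f w unitDisk) {t : ℝ} (ht : 0 < t)
    (θ : ℝ) : ‖pt (cylOf f) t θ‖ ^ 2 = Real.exp (2 * cylFactor w t θ)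
      ∧ ‖pth (cylOf f) t θ‖ ^ 2 = Real.exp (2 * cylFactor w t θ)
      ∧ ⟪pt (cylOf f) t θ, pth (cylOf f) t θ⟫_ℝ = 0 := by
  have hf : DiskSmooth f := h.smooth_f
  have hm := polar_mem ht θ
  have hx := h.conf_x _ hm
  have hy := h.conf_y _ hm
  have ho := h.conf_orth _ hm
  have ho' := ho
  rw [real_inner_comm] at ho'
  rw [← real_inner_self_eq_norm_sq] at hx hy
  rw [cylOf_eq_polar, hf.pt_polar ht, hf.pth_polar ht, exp_two_mul_cylFactor,
    ← real_inner_self_eq_norm_sq, ← real_inner_self_eq_norm_sq]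
  simp only [polar, inner_add_left, inner_add_right, inner_neg_left, inner_neg_right,
    real_inner_smul_left, real_inner_smul_right, hx, hy, ho, ho']
  refine ⟨?_, ?_, ?_⟩ <;> ring

lemma DiskConfWillmore.tau1_cyl (h : DiskConfWillmore f w unitDisk) {t : ℝ} (ht : 0 < t)
    (c : EuclideanSpace ℝ (Fin n)) : tau1 (cylOf f) (cylFactor w) c t = 0 := by
  have hf : DiskSmooth f := h.smooth_f
  have hw : DiskSmooth w := h.smooth_w
  have key := flux_combination_eq_zero (hf.Hmc hw).pt (hf.Hmc hw).pth (hf.shapeT hw)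
    (hf.shapeTh hw) (hf.energyT hw) (hf.energyTh hw) (-2) 4 ht
    (pt_Hmc_cyl hf hw ht) (shapeT_cyl hf hw ht) (energyT_cyl hf ht) (fun x y hp => by
      rw [← neg_eq_zero, ← h.willmore _ hp, willmoreOp_eq]
      module)
  rw [← inner_zero_left c]
  exact congrArg (fun v => ⟪v, c⟫_ℝ) key

lemma inner_toEuclideanLin_of_skew {S : Matrix (Fin n) (Fin n) ℝ} (hS : S.transpose = -S)
    (a b : EuclideanSpace ℝ (Fin n)) :
    ⟪a, Matrix.toEuclideanLin S b⟫_ℝ = -⟪b, Matrix.toEuclideanLin S a⟫_ℝ := by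
  have h1 := LinearMap.adjoint_inner_left (Matrix.toEuclideanLin S) b a
  rw [← Matrix.toEuclideanLin_conjTranspose_eq_adjoint,
    Matrix.conjTranspose_eq_transpose_of_trivial, hS, map_neg, LinearMap.neg_apply, inner_neg_left] at h1
  rw [← h1, real_inner_comm]

/-- The product of the shape field with an infinitesimal rotation has vanishing trace. -/
lemma inner_shape_skew (L : EuclideanSpace ℝ (Fin n) →L[ℝ] EuclideanSpace ℝ (Fin n))
    (hL : ∀ a b, ⟪a, L b⟫_ℝ = -⟪b, L a⟫_ℝ) (x y : ℝ) :
    ⟪shapeT f w x y, L (pt f x y)⟫_ℝ + ⟪shapeTh f w x y, L (pth f x y)⟫_ℝ = 0 := by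
  have h1 := hL (pt f x y) (pt f x y)
  have h2 := hL (pth f x y) (pth f x y)
  have h3 := hL (pt f x y) (pth f x y)
  simp only [shapeT, shapeTh, inner_add_left, real_inner_smul_left]
  have h1' : ⟪pt f x y, L (pt f x y)⟫_ℝ = 0 := by linarith
  have h2' : ⟪pth f x y, L (pth f x y)⟫_ℝ = 0 := by linarith
  rw [h1', h2', h3]
  ring

lemma inner_energy_skew (L : EuclideanSpace ℝ (Fin n) →L[ℝ] EuclideanSpace ℝ (Fin n))
    (hL : ∀ a b, ⟪a, L b⟫_ℝ = -⟪b, L a⟫_ℝ) (x y : ℝ) :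
    ⟪energyT f w x y, L (pt f x y)⟫_ℝ + ⟪energyTh f w x y, L (pth f x y)⟫_ℝ = 0 := by
  have h1 := hL (pt f x y) (pt f x y)
  have h2 := hL (pth f x y) (pth f x y)
  simp only [energyT, energyTh, real_inner_smul_left]
  have h1' : ⟪pt f x y, L (pt f x y)⟫_ℝ = 0 := by linarith
  have h2' : ⟪pth f x y, L (pth f x y)⟫_ℝ = 0 := by linarith
  rw [h1', h2']
  ring

lemma inner_Hmc_skew (L : EuclideanSpace ℝ (Fin n) →L[ℝ] EuclideanSpace ℝ (Fin n))
    (hL : ∀ a b, ⟪a, L b⟫_ℝ = -⟪b, L a⟫_ℝ) (x y : ℝ) :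
    ⟪Hmc f w x y, L (pt (pt f) x y)⟫_ℝ + ⟪Hmc f w x y, L (pth (pth f) x y)⟫_ℝ = 0 := by
  have h := hL (pt (pt f) x y + pth (pth f) x y) (pt (pt f) x y + pth (pth f) x y)
  have h' : ⟪pt (pt f) x y + pth (pth f) x y, L (pt (pt f) x y + pth (pth f) x y)⟫_ℝ = 0 := by
    linarith
  rw [← inner_add_right, ← map_add, Hmc, real_inner_smul_left, h', mul_zero]

/-- The divergence of `⟨U, L f⟩, ⟨V, L f⟩`. -/
lemma div_inner_clm {U V : ℝ → ℝ → EuclideanSpace ℝ (Fin n)} (hU : DiskSmooth U)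
    (hV : DiskSmooth V) (hf : DiskSmooth f)
    (L : EuclideanSpace ℝ (Fin n) →L[ℝ] EuclideanSpace ℝ (Fin n)) {x y : ℝ}
    (hp : (x, y) ∈ unitDisk) :
    pt (fun x y => ⟪U x y, L (f x y)⟫_ℝ) x y + pth (fun x y => ⟪V x y, L (f x y)⟫_ℝ) x y =
      ⟪pt U x y + pth V x y, L (f x y)⟫_ℝ
        + (⟪U x y, L (pt f x y)⟫_ℝ + ⟪V x y, L (pth f x y)⟫_ℝ) := by
  have e1 := ((hU.hasDerivAt_pt hp).inner ℝ
    (L.hasFDerivAt.comp_hasDerivAt x (hf.hasDerivAt_pt hp))).deriv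
  have e2 := ((hV.hasDerivAt_pth hp).inner ℝ
    (L.hasFDerivAt.comp_hasDerivAt y (hf.hasDerivAt_pth hp))).deriv
  refine (congrArg₂ (· + ·) e1 e2).trans ?_
  simp only [inner_add_left, Function.comp]
  ring

lemma DiskConfWillmore.tau2_cyl (h : DiskConfWillmore f w unitDisk) {t : ℝ} (ht : 0 < t)
    {S : Matrix (Fin n) (Fin n) ℝ} (hS : S.transpose = -S) :
    tau2 (cylOf f) (cylFactor w) S t = 0 := by
  have hf : DiskSmooth f := h.smooth_f
  have hw : DiskSmooth w := h.smooth_w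
  have hH := hf.Hmc hw
  let L := LinearMap.toContinuousLinearMap (Matrix.toEuclideanLin S)
  have hL : ∀ a b, ⟪a, L b⟫_ℝ = -⟪b, L a⟫_ℝ := inner_toEuclideanLin_of_skew hS
  have hLf : DiskSmooth fun x y => L (f x y) := hf.clm L
  have hpt : ∀ θ, pt (fun a b => Matrix.toEuclideanLin S (cylOf f a b)) t θ =
      L (pt (cylOf f) t θ) := fun θ => by
    have hd := hf.hasDerivAt_polar_t ht θ
    rw [cylOf_eq_polar, hf.pt_polar ht]
    exact (L.hasFDerivAt.comp_hasDerivAt t hd).deriv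
  have key := flux_combination_eq_zero
    ((hH.inner (hf.pt.clm L)).sub (hH.pt.inner hLf))
    ((hH.inner (hf.pth.clm L)).sub (hH.pth.inner hLf))
    ((hf.shapeT hw).inner hLf) ((hf.shapeTh hw).inner hLf)
    ((hf.energyT hw).inner hLf) ((hf.energyTh hw).inner hLf) 2 4 ht
    (A := fun θ => ⟪Hmc (cylOf f) (cylFactor w) t θ,
        pt (fun a b => Matrix.toEuclideanLin S (cylOf f a b)) t θ⟫_ℝ
      - ⟪pt (Hmc (cylOf f) (cylFactor w)) t θ, L (cylOf f t θ)⟫_ℝ)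
    (B := fun θ => ⟪shapeT (cylOf f) (cylFactor w) t θ, L (cylOf f t θ)⟫_ℝ)
    (C := fun θ => ⟪energyT (cylOf f) (cylFactor w) t θ, L (cylOf f t θ)⟫_ℝ)
    (fun θ => by
      rw [hpt, Hmc_cyl hf ht, pt_Hmc_cyl hf hw ht, cylOf_eq_polar, hf.pt_polar ht]
      simp only [polar, map_neg, map_add, map_smul, inner_neg_left, inner_neg_right,
        inner_add_left, inner_add_right, real_inner_smul_left, real_inner_smul_right, smul_eq_mul]
      ring)
    (fun θ => by
      rw [shapeT_cyl hf hw ht, cylOf_eq_polar]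
      simp only [polar, inner_neg_left, inner_add_left, real_inner_smul_left, smul_eq_mul])
    (fun θ => by
      rw [energyT_cyl hf ht, cylOf_eq_polar]
      simp only [polar, inner_neg_left, inner_add_left, real_inner_smul_left, smul_eq_mul])
    (fun x y hp => by
      have e1 : pt (fun x y => ⟪Hmc f w x y, L (pt f x y)⟫_ℝ
          - ⟪pt (Hmc f w) x y, L (f x y)⟫_ℝ) x y = _ :=
        (((hH.hasDerivAt_pt hp).inner ℝ
          (L.hasFDerivAt.comp_hasDerivAt x (hf.pt.hasDerivAt_pt hp))).sub
        ((hH.pt.hasDerivAt_pt hp).inner ℝ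
          (L.hasFDerivAt.comp_hasDerivAt x (hf.hasDerivAt_pt hp)))).deriv
      have e2 : pth (fun x y => ⟪Hmc f w x y, L (pth f x y)⟫_ℝ
          - ⟪pth (Hmc f w) x y, L (f x y)⟫_ℝ) x y = _ :=
        (((hH.hasDerivAt_pth hp).inner ℝ
          (L.hasFDerivAt.comp_hasDerivAt y (hf.pth.hasDerivAt_pth hp))).sub
        ((hH.pth.hasDerivAt_pth hp).inner ℝ
          (L.hasFDerivAt.comp_hasDerivAt y (hf.hasDerivAt_pth hp)))).deriv
      have hW := congrArg (fun v => ⟪v, L (f x y)⟫_ℝ) (h.willmore _ hp)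
      simp only [willmoreOp_eq, inner_add_left, inner_sub_left, real_inner_smul_left,
        inner_zero_left] at hW
      rw [div_inner_clm (hf.shapeT hw) (hf.shapeTh hw) hf L hp,
        div_inner_clm (hf.energyT hw) (hf.energyTh hw) hf L hp,
        inner_shape_skew L hL, inner_energy_skew L hL, e1, e2]
      simp only [inner_add_left, Function.comp, smul_eq_mul]
      linear_combination 2 * inner_Hmc_skew (f := f) (w := w) L hL x y - hW)
  refine Eq.trans ?_ key
  simp only [tau2, shapeT, energyT, real_inner_smul_left, inner_add_left, smul_eq_mul]
  rfl

end Willmore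

/-- **Theorem 2.1** (Pohozaev-type identity): a conformal Willmore immersion of the unit
disk induces, in cylindrical coordinates, a conformal Willmore immersion of `(0,∞) × S¹`
whose residues `τ₁` and `τ₂` all vanish. -/
theorem pohozaev_identity (n : ℕ) (f : ℝ → ℝ → EuclideanSpace ℝ (Fin n)) (w : ℝ → ℝ → ℝ)
    (hf : DiskConfWillmore f w unitDisk) :
    ContDiffOn ℝ (⊤ : ℕ∞) (fun p : ℝ × ℝ => cylOf f p.1 p.2)
      (Set.Ioi (0 : ℝ) ×ˢ (Set.univ : Set ℝ))
    ∧ (∀ t θ : ℝ, cylOf f t (θ + 2 * π) = cylOf f t θ)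
    ∧ (∀ t ∈ Set.Ioi (0 : ℝ), ∀ θ : ℝ,
        ‖pt (cylOf f) t θ‖ ^ 2 = Real.exp (2 * cylFactor w t θ)
        ∧ ‖pth (cylOf f) t θ‖ ^ 2 = Real.exp (2 * cylFactor w t θ)
        ∧ ⟪pt (cylOf f) t θ, pth (cylOf f) t θ⟫_ℝ = 0
        ∧ willmoreOp (cylOf f) (cylFactor w) t θ = 0)
    ∧ (∀ t ∈ Set.Ioi (0 : ℝ),
        (∀ c : EuclideanSpace ℝ (Fin n), tau1 (cylOf f) (cylFactor w) c t = 0)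
        ∧ ∀ S : Matrix (Fin n) (Fin n) ℝ, S.transpose = -S →
            tau2 (cylOf f) (cylFactor w) S t = 0) := by
  have hs : DiskSmooth f := hf.smooth_f
  have hw : DiskSmooth w := hf.smooth_w
  refine ⟨?_, fun t θ => by simp [cylOf], fun t ht θ => ?_, fun t ht =>
    ⟨hf.tau1_cyl ht, fun S hS => hf.tau2_cyl ht hS⟩⟩
  · exact ContDiffOn.comp (g := fun p : ℝ × ℝ => f p.1 p.2) hs
      (f := fun p : ℝ × ℝ => (polarX p.1 p.2, polarY p.1 p.2))
      (by unfold polarX polarY; fun_prop) fun p hp => polar_mem hp.1 p.2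
  · obtain ⟨h1, h2, h3⟩ := hf.conformal_cyl ht θ
    refine ⟨h1, h2, h3, ?_⟩
    rw [willmoreOp_cyl hs hw ht, polar, hf.willmore _ (polar_mem ht θ), smul_zero]
end
end

section
/- (Weighted three-circle lemma for harmonic functions, Lemma 3.2.) For every positive integer m and every q ∈ (0,2) there is L₀ > 0 (depending on m, q) such that for all L > L₀ the following holds. Let u : [0,3L]×ℝ → ℝ be harmonic (∂_t²u + ∂_θ²u = 0), 2π-periodic in θ, and not identically zero. Define g(t) := ∫₀^{2π} u(t,θ) cos(mθ) dθ and h(t) := ∫₀^{2π} u(t,θ) sin(mθ) dθ, and assume g'(0) = −m g(0) and h'(0) = −m h(0) (equivalently, the coefficients of e^{mt}cos(mθ) and e^{mt}sin(mθ) in the Fourier expansion of u vanish). Then ∫_{Q₂} u² e^{−2mt} dt dθ < e^{−qL} ( ∫_{Q₁} u² e^{−2mt} dt dθ + ∫_{Q₃} u² e^{−2mt} dt dθ ). -/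
noncomputable section

open Real MeasureTheory Set Filter
open scoped InnerProductSpace

variable {n : ℕ}

lemma eq_exp_combination_of_hasDerivAt {f f' : ℝ → ℂ} {κ T : ℝ} (hκ : κ ≠ 0)
    (hf : ∀ t, HasDerivAt f (f' t) t)
    (hf' : ∀ t ∈ Icc 0 T, HasDerivAt f' ((κ : ℂ) ^ 2 * f t) t) {t : ℝ} (ht : t ∈ Icc 0 T) :
    f t = (f' 0 + κ * f 0) / (2 * κ) * (rexp (κ * t) : ℝ)
      + (κ * f 0 - f' 0) / (2 * κ) * (rexp (-(κ * t)) : ℝ) := by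
  have hexp (c s : ℝ) : HasDerivAt (fun s : ℝ => ((rexp (c * s) : ℝ) : ℂ))
      ((rexp (c * s) * c : ℝ) : ℂ) s := by
    have h1 : HasDerivAt (fun s : ℝ => rexp (c * s)) (rexp (c * s) * c) s := by
      simpa using ((hasDerivAt_id s).const_mul c).exp
    exact h1.ofReal_comp
  have key (c : ℝ) (hc : c ^ 2 = κ ^ 2) :
      (f' t + c * f t) * (rexp (-c * t) : ℝ) = f' 0 + c * f 0 := by
    have hd : ∀ s ∈ Icc 0 T,
        HasDerivAt (fun s => (f' s + c * f s) * ((rexp (-c * s) : ℝ) : ℂ)) 0 s := by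
      intro s hs
      have h2 := ((hf' s hs).add ((hf s).const_mul (c : ℂ))).mul (hexp (-c) s)
      refine h2.congr_deriv ?_
      have hc' : (κ : ℂ) ^ 2 = (c : ℂ) ^ 2 := by exact_mod_cast hc.symm
      push_cast
      simp only [Pi.add_apply]
      rw [hc']
      ring
    have := constant_of_has_deriv_right_zero
      (fun s hs => (hd s hs).continuousAt.continuousWithinAt)
      (fun s hs => (hd s (Ico_subset_Icc_self hs)).hasDerivWithinAt) t ht
    simpa using this
  have h1 := key κ rfl
  have h2 := key (-κ) (by ring)
  have he : ((rexp (κ * t) : ℝ) : ℂ) * ((rexp (-(κ * t)) : ℝ) : ℂ) = 1 := by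
    rw [← Complex.ofReal_mul, ← Real.exp_add]; simp
  have hκ' : (κ : ℂ) ≠ 0 := by exact_mod_cast hκ
  simp only [neg_mul, neg_neg] at h1 h2
  push_cast at h2
  rw [← h1, show κ * f 0 - f' 0 = -(f' 0 + -κ * f 0) by ring, ← h2]
  push_cast at he ⊢
  field_simp
  linear_combination (-2 * κ * f t) * he

lemma eq_affine_of_hasDerivAt {f f' : ℝ → ℂ} {T : ℝ}
    (hf : ∀ t, HasDerivAt f (f' t) t)
    (hf' : ∀ t ∈ Icc 0 T, HasDerivAt f' 0 t) {t : ℝ} (ht : t ∈ Icc 0 T) :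
    f t = f 0 + f' 0 * t := by
  have hc : ∀ s ∈ Icc 0 T, f' s = f' 0 := constant_of_has_deriv_right_zero
    (fun s hs => (hf' s hs).continuousAt.continuousWithinAt)
    (fun s hs => (hf' s (Ico_subset_Icc_self hs)).hasDerivWithinAt)
  have hd : ∀ s ∈ Icc 0 T, HasDerivAt (fun s : ℝ => f s - f' 0 * s) 0 s := by
    intro s hs
    refine ((hf s).sub (((hasDerivAt_id s).ofReal_comp).const_mul (f' 0))).congr_deriv ?_
    simp [hc s hs]
  have := constant_of_has_deriv_right_zero
    (fun s hs => (hd s hs).continuousAt.continuousWithinAt)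
    (fun s hs => (hd s (Ico_subset_Icc_self hs)).hasDerivWithinAt) t ht
  simp only [Complex.ofReal_zero, mul_zero, sub_zero] at this
  linear_combination this

lemma sq_le_of_mul_le_add {A x y z B : ℝ} (hA : 0 ≤ A) (hx : 0 ≤ x)
    (h : A * x ≤ B * (y + z)) : A ^ 2 * x ^ 2 ≤ 2 * B ^ 2 * (y ^ 2 + z ^ 2) := by
  have h1 : (A * x) ^ 2 ≤ (B * (y + z)) ^ 2 := by gcongr
  nlinarith [mul_nonneg (sq_nonneg B) (sq_nonneg (y - z))]

/-- A mode of frequency above `m`: the weighted square is controlled by the two neighbours. -/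
lemma weighted_sq_le_of_lt {f : ℝ → ℂ} {P Q : ℂ} {m κ L t : ℝ} (hκ : m + 1 ≤ κ) (hm : 0 ≤ m)
    (hL : 0 ≤ L) (hf : ∀ s ∈ Icc (t - L) (t + L),
      f s = P * (rexp (κ * s) : ℝ) + Q * (rexp (-(κ * s)) : ℝ)) :
    ‖f t‖ ^ 2 * rexp (-(2 * m * t)) ≤ 2 * rexp (-(2 * L)) *
      (‖f (t - L)‖ ^ 2 * rexp (-(2 * m * (t - L)))
        + ‖f (t + L)‖ ^ 2 * rexp (-(2 * m * (t + L)))) := by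
  have hid : ((rexp (κ * L) + rexp (-(κ * L)) : ℝ) : ℂ) * f t = f (t - L) + f (t + L) := by
    rw [hf t (by constructor <;> linarith), hf (t - L) (by constructor <;> linarith),
      hf (t + L) (by constructor <;> linarith)]
    simp only [mul_add, neg_add, Real.exp_add, sub_eq_add_neg, mul_neg, neg_neg]
    push_cast
    ring
  have hn : rexp (κ * L) * ‖f t‖ ≤ 1 * (‖f (t - L)‖ + ‖f (t + L)‖) := by
    calc rexp (κ * L) * ‖f t‖ ≤ (rexp (κ * L) + rexp (-(κ * L))) * ‖f t‖ := by
          gcongr; linarith [Real.exp_pos (-(κ * L))]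
      _ = ‖f (t - L) + f (t + L)‖ := by
          rw [← hid, norm_mul, Complex.norm_real, Real.norm_of_nonneg (by positivity)]
      _ ≤ 1 * (‖f (t - L)‖ + ‖f (t + L)‖) := by rw [one_mul]; exact norm_add_le _ _
  have hsq := sq_le_of_mul_le_add (Real.exp_pos _).le (norm_nonneg _) hn
  have h2 : rexp (-(2 * m * t)) = rexp (-(2 * m * (t + L))) * rexp (2 * m * L) := by
    rw [← Real.exp_add]; ring_nf
  have h3 : rexp (-(2 * m * t)) ≤ rexp (-(2 * m * (t - L))) * rexp (2 * m * L) := by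
    rw [← Real.exp_add]; gcongr; nlinarith [mul_nonneg hm hL]
  have h4 : 1 ≤ rexp (κ * L) ^ 2 * rexp (-(2 * L)) * rexp (-(2 * m * L)) := by
    rw [← Real.exp_nat_mul, ← Real.exp_add, ← Real.exp_add]
    apply Real.one_le_exp; push_cast; nlinarith
  have h5 : rexp (-(2 * m * L)) * rexp (2 * m * L) = 1 := by rw [← Real.exp_add]; simp
  calc ‖f t‖ ^ 2 * rexp (-(2 * m * t))
      ≤ (rexp (κ * L) ^ 2 * rexp (-(2 * L)) * rexp (-(2 * m * L))) *
          (‖f t‖ ^ 2 * rexp (-(2 * m * t))) := le_mul_of_one_le_left (by positivity) h4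
    _ = rexp (-(2 * L)) * rexp (-(2 * m * L)) * rexp (-(2 * m * t)) *
          (rexp (κ * L) ^ 2 * ‖f t‖ ^ 2) := by ring
    _ ≤ rexp (-(2 * L)) * rexp (-(2 * m * L)) * rexp (-(2 * m * t)) *
          (2 * 1 ^ 2 * (‖f (t - L)‖ ^ 2 + ‖f (t + L)‖ ^ 2)) := by gcongr
    _ = 2 * rexp (-(2 * L)) * rexp (-(2 * m * L)) *
          (‖f (t - L)‖ ^ 2 * rexp (-(2 * m * t)) + ‖f (t + L)‖ ^ 2 * rexp (-(2 * m * t))) := by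
        ring
    _ ≤ 2 * rexp (-(2 * L)) * rexp (-(2 * m * L)) *
          (‖f (t - L)‖ ^ 2 * (rexp (-(2 * m * (t - L))) * rexp (2 * m * L))
            + ‖f (t + L)‖ ^ 2 * (rexp (-(2 * m * (t + L))) * rexp (2 * m * L))) := by
        gcongr
        exact h2.le
    _ = 2 * rexp (-(2 * L)) * (rexp (-(2 * m * L)) * rexp (2 * m * L)) *
          (‖f (t - L)‖ ^ 2 * rexp (-(2 * m * (t - L)))
            + ‖f (t + L)‖ ^ 2 * rexp (-(2 * m * (t + L)))) := by ring
    _ = _ := by rw [h5, mul_one]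

/-- The resonant mode: only the decaying exponential of rate `m` is present. -/
lemma weighted_sq_le_of_decay {f : ℝ → ℂ} {Q : ℂ} {m L t : ℝ} (hm : 1 ≤ m) (hL : 0 ≤ L)
    (hf : ∀ s ∈ Icc (t - L) t, f s = Q * (rexp (-(m * s)) : ℝ)) :
    ‖f t‖ ^ 2 * rexp (-(2 * m * t)) ≤
      2 * rexp (-(2 * L)) * (‖f (t - L)‖ ^ 2 * rexp (-(2 * m * (t - L)))) := by
  rw [hf t (by constructor <;> linarith), hf (t - L) (by constructor <;> linarith)]
  simp only [norm_mul, Complex.norm_real, Real.norm_eq_abs, Real.abs_exp, mul_pow]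
  have h1 : rexp (-(m * t)) ^ 2 * rexp (-(2 * m * t)) ≤
      2 * rexp (-(2 * L)) * (rexp (-(m * (t - L))) ^ 2 * rexp (-(2 * m * (t - L)))) := by
    calc rexp (-(m * t)) ^ 2 * rexp (-(2 * m * t))
        ≤ rexp (-(2 * L)) * (rexp (-(m * (t - L))) ^ 2 * rexp (-(2 * m * (t - L)))) := by
          simp only [← Real.exp_nat_mul, ← Real.exp_add]
          refine Real.exp_le_exp.2 ?_
          push_cast; nlinarith
      _ ≤ _ := by gcongr; linarith [Real.exp_pos (-(2 * L))]
  calc _ = ‖Q‖ ^ 2 * (rexp (-(m * t)) ^ 2 * rexp (-(2 * m * t))) := by ring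
    _ ≤ ‖Q‖ ^ 2 * (2 * rexp (-(2 * L)) *
        (rexp (-(m * (t - L))) ^ 2 * rexp (-(2 * m * (t - L))))) := by gcongr
    _ = _ := by ring

lemma abs_sinh_mul_le_exp {κ x R : ℝ} (hκ : 0 ≤ κ) (hx : 0 ≤ x) (hxR : x ≤ R) :
    |Real.sinh (κ * x)| ≤ rexp (κ * R) := by
  rw [abs_of_nonneg (Real.sinh_nonneg_iff.2 (by positivity))]
  have h1 : rexp (κ * x) ≤ rexp (κ * R) := by gcongr
  rw [Real.sinh_eq]
  linarith [Real.exp_pos (κ * x), Real.exp_pos (-(κ * x))]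

/-- Extrapolation of a mode from two points at unit distance. -/
lemma norm_le_of_exp_combination {f : ℝ → ℂ} {P Q : ℂ} {κ L t t₁ t₂ : ℝ} (hκ : 1 ≤ κ)
    (h12 : t₂ = t₁ + 1) (h1 : 0 ≤ t - t₁) (h1' : t - t₁ ≤ L + 1) (h2 : 0 ≤ t - t₂)
    (hf : ∀ s ∈ ({t, t₁, t₂} : Set ℝ),
      f s = P * (rexp (κ * s) : ℝ) + Q * (rexp (-(κ * s)) : ℝ)) :
    ‖f t‖ ≤ rexp (κ * (L + 1)) * (‖f t₁‖ + ‖f t₂‖) := by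
  have hid : ((Real.sinh κ : ℝ) : ℂ) * f t
      = (Real.sinh (κ * (t - t₁)) : ℝ) * f t₂ - (Real.sinh (κ * (t - t₂)) : ℝ) * f t₁ := by
    have ha : rexp (κ * t₁) * rexp (-(κ * t₁)) = 1 := by rw [← Real.exp_add]; simp
    rw [hf t (by simp), hf t₁ (by simp), hf t₂ (by simp), h12]
    simp only [Real.sinh_eq, mul_add, neg_add, Real.exp_add, sub_eq_add_neg, mul_neg, neg_neg,
      mul_one]
    have ha' : ((rexp (κ * t₁) : ℝ) : ℂ) * (rexp (-(κ * t₁)) : ℝ) = 1 := by exact_mod_cast ha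
    push_cast at *
    set E := Complex.exp (κ * t)
    set E' := Complex.exp (-(κ * t))
    set F := Complex.exp (κ * t₁)
    set F' := Complex.exp (-(κ * t₁))
    set G := Complex.exp κ
    set G' := Complex.exp (-κ)
    linear_combination (-(P * E * G - P * E * G' + Q * E' * G - Q * E' * G') / 2) * ha'
  have hs : 1 ≤ Real.sinh κ := hκ.trans (Real.self_le_sinh_iff.2 (by linarith))
  calc ‖f t‖ ≤ Real.sinh κ * ‖f t‖ := le_mul_of_one_le_left (norm_nonneg _) hs
    _ = ‖((Real.sinh κ : ℝ) : ℂ) * f t‖ := by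
        rw [norm_mul, Complex.norm_real, Real.norm_of_nonneg (by linarith)]
    _ ≤ |Real.sinh (κ * (t - t₁))| * ‖f t₂‖ + |Real.sinh (κ * (t - t₂))| * ‖f t₁‖ := by
        rw [hid]
        refine (norm_sub_le _ _).trans_eq ?_
        simp only [norm_mul, Complex.norm_real, Real.norm_eq_abs]
    _ ≤ rexp (κ * (L + 1)) * ‖f t₂‖ + rexp (κ * (L + 1)) * ‖f t₁‖ := by
        gcongr
        · exact abs_sinh_mul_le_exp (by linarith) h1 h1'
        · exact abs_sinh_mul_le_exp (by linarith) h2 (by linarith)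
    _ = _ := by ring

lemma norm_le_of_affine {f : ℝ → ℂ} {P Q : ℂ} {L t t₁ t₂ : ℝ}
    (h12 : t₂ = t₁ + 1) (h1 : 0 ≤ t - t₁) (h1' : t - t₁ ≤ L + 1) (h2 : 0 ≤ t - t₂)
    (hf : ∀ s ∈ ({t, t₁, t₂} : Set ℝ), f s = P + Q * s) :
    ‖f t‖ ≤ (L + 1) * (‖f t₁‖ + ‖f t₂‖) := by
  have hid : f t = ((t - t₁ : ℝ) : ℂ) * f t₂ - ((t - t₂ : ℝ) : ℂ) * f t₁ := by
    rw [hf t (by simp), hf t₁ (by simp), hf t₂ (by simp), h12]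
    push_cast
    ring
  calc ‖f t‖ ≤ |t - t₁| * ‖f t₂‖ + |t - t₂| * ‖f t₁‖ := by
        rw [hid]
        refine (norm_sub_le _ _).trans_eq ?_
        simp only [norm_mul, Complex.norm_real, Real.norm_eq_abs]
    _ ≤ (L + 1) * ‖f t₂‖ + (L + 1) * ‖f t₁‖ := by
        gcongr
        · rwa [abs_of_nonneg h1]
        · rw [abs_of_nonneg h2]; linarith
    _ = _ := by ring

lemma weighted_sq_le_of_norm_le {f : ℝ → ℂ} {m κ L t t₁ t₂ : ℝ} (hL : 1 ≤ L)
    (hκ : 0 ≤ κ) (hκm : κ + 1 ≤ m) (h1 : L - 1 ≤ t - t₁) (h2 : L - 1 ≤ t - t₂)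
    (h : ‖f t‖ ≤ (L + 1) * rexp (κ * (L + 1)) * (‖f t₁‖ + ‖f t₂‖)) :
    ‖f t‖ ^ 2 * rexp (-(2 * m * t)) ≤ 2 * (L + 1) ^ 2 * rexp (4 * m) * rexp (-(2 * L)) *
      (‖f t₁‖ ^ 2 * rexp (-(2 * m * t₁)) + ‖f t₂‖ ^ 2 * rexp (-(2 * m * t₂))) := by
  have hsq := sq_le_of_mul_le_add (A := 1) (B := (L + 1) * rexp (κ * (L + 1))) zero_le_one
    (norm_nonneg _) (by simpa using h)
  have hw (s : ℝ) (hs : L - 1 ≤ t - s) : rexp (κ * (L + 1)) ^ 2 * rexp (-(2 * m * t)) ≤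
      rexp (4 * m) * rexp (-(2 * L)) * rexp (-(2 * m * s)) := by
    simp only [← Real.exp_nat_mul, ← Real.exp_add]
    refine Real.exp_le_exp.2 ?_
    push_cast
    nlinarith [mul_le_mul_of_nonneg_left hs (by linarith : 0 ≤ m),
      mul_le_mul_of_nonneg_right hκm (by linarith : 0 ≤ L + 1)]
  calc ‖f t‖ ^ 2 * rexp (-(2 * m * t))
      = (1 ^ 2 * ‖f t‖ ^ 2) * rexp (-(2 * m * t)) := by ring
    _ ≤ (2 * ((L + 1) * rexp (κ * (L + 1))) ^ 2 * (‖f t₁‖ ^ 2 + ‖f t₂‖ ^ 2)) *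
          rexp (-(2 * m * t)) := by gcongr
    _ = 2 * (L + 1) ^ 2 * (‖f t₁‖ ^ 2 * (rexp (κ * (L + 1)) ^ 2 * rexp (-(2 * m * t)))
          + ‖f t₂‖ ^ 2 * (rexp (κ * (L + 1)) ^ 2 * rexp (-(2 * m * t)))) := by ring
    _ ≤ 2 * (L + 1) ^ 2 * (‖f t₁‖ ^ 2 * (rexp (4 * m) * rexp (-(2 * L)) * rexp (-(2 * m * t₁)))
          + ‖f t₂‖ ^ 2 * (rexp (4 * m) * rexp (-(2 * L)) * rexp (-(2 * m * t₂)))) := by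
        have h3 := hw _ h1
        have h4 := hw _ h2
        gcongr ?_ * (_ * ?_ + _ * ?_)
    _ = _ := by ring

lemma integral_le_of_le_shift_add_shift {N : ℝ → ℝ} (hN : Continuous N) {C L : ℝ} (hL : 0 ≤ L)
    (h : ∀ t ∈ Icc L (2 * L), N t ≤ C * (N (t - L) + N (t + L))) :
    ∫ t in L..2 * L, N t ≤ C * ((∫ t in 0..L, N t) + ∫ t in 2 * L..3 * L, N t) := by
  have h1 : ∫ t in L..2 * L, N (t - L) = ∫ t in 0..L, N t := by
    rw [intervalIntegral.integral_comp_sub_right]; congr 1 <;> ring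
  have h2 : ∫ t in L..2 * L, N (t + L) = ∫ t in 2 * L..3 * L, N t := by
    rw [intervalIntegral.integral_comp_add_right]; congr 1 <;> ring
  have hm : Continuous fun t => N (t - L) := by fun_prop
  have hp : Continuous fun t => N (t + L) := by fun_prop
  rw [← h1, ← h2, ← intervalIntegral.integral_add (hm.intervalIntegrable _ _)
    (hp.intervalIntegrable _ _), ← intervalIntegral.integral_const_mul]
  exact intervalIntegral.integral_mono_on (by linarith) (hN.intervalIntegrable _ _)
    ((by fun_prop : Continuous fun t => C * (N (t - L) + N (t + L))).intervalIntegrable _ _) h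

lemma integral_comp_sub_le_of_subinterval {N : ℝ → ℝ} (hN : Continuous N) (hN0 : ∀ t, 0 ≤ N t)
    {a b d L : ℝ} (hab : a ≤ b) (ha : 0 ≤ a - d) (hb : b - d ≤ L) :
    ∫ t in a..b, N (t - d) ≤ ∫ t in 0..L, N t := by
  rw [intervalIntegral.integral_comp_sub_right]
  exact intervalIntegral.integral_mono_interval ha (by linarith) hb
    (Eventually.of_forall hN0) (hN.intervalIntegrable _ _)

lemma integral_le_of_le_unit_shifts {N : ℝ → ℝ} (hN : Continuous N) (hN0 : ∀ t, 0 ≤ N t)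
    {C L : ℝ} (hC : 0 ≤ C) (hL : 2 ≤ L)
    (h1 : ∀ t ∈ Icc L (2 * L - 1), N t ≤ C * (N (t - L) + N (t - (L - 1))))
    (h2 : ∀ t ∈ Icc (2 * L - 1) (2 * L), N t ≤ C * (N (t - (L + 1)) + N (t - L))) :
    ∫ t in L..2 * L, N t ≤ 4 * C * ∫ t in 0..L, N t := by
  have key {a b d e : ℝ} (hab : a ≤ b) (hd : 0 ≤ a - d) (hd' : b - d ≤ L) (he : 0 ≤ a - e)
      (he' : b - e ≤ L) (h : ∀ t ∈ Icc a b, N t ≤ C * (N (t - d) + N (t - e))) :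
      ∫ t in a..b, N t ≤ 2 * C * ∫ t in 0..L, N t := by
    have c1 : Continuous fun t => N (t - d) := by fun_prop
    have c2 : Continuous fun t => N (t - e) := by fun_prop
    calc ∫ t in a..b, N t ≤ ∫ t in a..b, C * (N (t - d) + N (t - e)) :=
          intervalIntegral.integral_mono_on hab (hN.intervalIntegrable _ _)
            ((by fun_prop : Continuous fun t => C * (N (t - d) + N (t - e))).intervalIntegrable
              _ _) h
      _ = C * ((∫ t in a..b, N (t - d)) + ∫ t in a..b, N (t - e)) := by
          rw [intervalIntegral.integral_const_mul, intervalIntegral.integral_add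
            (c1.intervalIntegrable _ _) (c2.intervalIntegrable _ _)]
      _ ≤ C * ((∫ t in 0..L, N t) + ∫ t in 0..L, N t) := by
          gcongr
          · exact integral_comp_sub_le_of_subinterval hN hN0 hab hd hd'
          · exact integral_comp_sub_le_of_subinterval hN hN0 hab he he'
      _ = _ := by ring
  rw [← intervalIntegral.integral_add_adjacent_intervals (b := 2 * L - 1)
    (hN.intervalIntegrable _ _) (hN.intervalIntegrable _ _)]
  have k1 := key (by linarith) (by linarith) (by linarith) (by linarith) (by linarith) h1
  have k2 := key (by linarith) (by linarith) (by linarith) (by linarith) (by linarith) h2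
  linarith

/-- The weighted three-circle inequality for a single Fourier mode, uniformly in the frequency. -/
lemma integral_mode_le {f f' : ℝ → ℂ} {m κ : ℕ} (hm : 0 < m) {L : ℝ} (hL : 2 ≤ L)
    (hf : ∀ t, HasDerivAt f (f' t) t)
    (hf' : ∀ t ∈ Icc 0 (3 * L), HasDerivAt f' ((κ : ℂ) ^ 2 * f t) t)
    (hres : κ = m → f' 0 = -m * f 0) :
    ∫ t in L..2 * L, ‖f t‖ ^ 2 * rexp (-(2 * (m : ℝ) * t)) ≤
      8 * (L + 1) ^ 2 * rexp (4 * m) * rexp (-(2 * L)) *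
        ((∫ t in 0..L, ‖f t‖ ^ 2 * rexp (-(2 * (m : ℝ) * t)))
          + ∫ t in 2 * L..3 * L, ‖f t‖ ^ 2 * rexp (-(2 * (m : ℝ) * t))) := by
  have hm1 : (1 : ℝ) ≤ m := by exact_mod_cast hm
  have hfc : Continuous f := continuous_iff_continuousAt.2 fun t => (hf t).continuousAt
  set N : ℝ → ℝ := fun t => ‖f t‖ ^ 2 * rexp (-(2 * (m : ℝ) * t)) with hNdef
  have hN : Continuous N := by fun_prop
  have hN0 (t : ℝ) : 0 ≤ N t := by positivity
  have hI1 : 0 ≤ ∫ t in 0..L, N t :=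
    intervalIntegral.integral_nonneg (by linarith) fun t _ => hN0 t
  have hI3 : 0 ≤ ∫ t in 2 * L..3 * L, N t :=
    intervalIntegral.integral_nonneg (by linarith) fun t _ => hN0 t
  have hexp (hκ : κ ≠ 0) {s : ℝ} (hs : s ∈ Icc 0 (3 * L)) :
      f s = (f' 0 + κ * f 0) / (2 * κ) * (rexp (κ * s) : ℝ)
        + (κ * f 0 - f' 0) / (2 * κ) * (rexp (-(κ * s)) : ℝ) := by
    have := eq_exp_combination_of_hasDerivAt (κ := (κ : ℝ)) (by exact_mod_cast hκ) hf
      (by simpa using hf') hs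
    simpa using this
  rcases lt_or_ge κ m with hlt | hge
  · have hκm : (κ : ℝ) + 1 ≤ m := by exact_mod_cast hlt
    have hpt {t t₁ t₂ : ℝ} (ht : t ∈ Icc 0 (3 * L)) (ht₁ : t₁ ∈ Icc 0 (3 * L))
        (ht₂ : t₂ ∈ Icc 0 (3 * L)) (h12 : t₂ = t₁ + 1) (h1 : L - 1 ≤ t - t₁)
        (h1' : t - t₁ ≤ L + 1) (h2 : L - 1 ≤ t - t₂) :
        N t ≤ 2 * (L + 1) ^ 2 * rexp (4 * m) * rexp (-(2 * L)) * (N t₁ + N t₂) := by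
      refine weighted_sq_le_of_norm_le (by linarith) κ.cast_nonneg hκm h1 h2 ?_
      have hmem {p : ℝ → Prop} (h₀ : ∀ s ∈ Icc 0 (3 * L), p s) :
          ∀ s ∈ ({t, t₁, t₂} : Set ℝ), p s := by
        rintro s (rfl | rfl | rfl) <;> exact h₀ _ ‹_›
      rcases Nat.eq_zero_or_pos κ with rfl | hκ
      · have := norm_le_of_affine h12 (by linarith) h1' (by linarith)
          (hmem fun s hs => eq_affine_of_hasDerivAt hf (by simpa using hf') hs)
        simpa using this
      · have := norm_le_of_exp_combination (κ := (κ : ℝ)) (by exact_mod_cast hκ) h12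
          (by linarith) h1' (by linarith) (hmem fun s hs => hexp hκ.ne' hs)
        refine this.trans ?_
        gcongr
        exact le_mul_of_one_le_left (by positivity) (by linarith)
    refine (integral_le_of_le_unit_shifts hN hN0
      (C := 2 * (L + 1) ^ 2 * rexp (4 * m) * rexp (-(2 * L))) (by positivity) hL
      (fun t ht => hpt ?_ ?_ ?_ ?_ ?_ ?_ ?_) (fun t ht => hpt ?_ ?_ ?_ ?_ ?_ ?_ ?_)).trans ?_
    any_goals first | (constructor <;> linarith [ht.1, ht.2]) | linarith [ht.1, ht.2]
    calc _ = 8 * (L + 1) ^ 2 * rexp (4 * m) * rexp (-(2 * L)) * ∫ t in 0..L, N t := by ring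
      _ ≤ _ := by gcongr; linarith
  · have hbound : ∀ t ∈ Icc L (2 * L),
        N t ≤ 2 * rexp (-(2 * L)) * (N (t - L) + N (t + L)) := by
      intro t ht
      rcases hge.eq_or_lt with heq | hgt
      · subst heq
        refine (weighted_sq_le_of_decay (f := f) (L := L) (Q := (m * f 0 - f' 0) / (2 * m)) hm1
          (by linarith) fun s hs => ?_).trans ?_
        · rw [hexp hm.ne' ⟨by linarith [hs.1, ht.1], by linarith [hs.2, ht.2]⟩, hres rfl]
          simp
        · gcongr
          exact le_add_of_nonneg_right (hN0 _)
      · exact weighted_sq_le_of_lt (κ := (κ : ℝ)) (by exact_mod_cast hgt) m.cast_nonneg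
          (by linarith) fun s hs => hexp (by lia)
            ⟨by linarith [hs.1, ht.1], by linarith [hs.2, ht.2]⟩
    refine (integral_le_of_le_shift_add_shift hN (by linarith) hbound).trans ?_
    gcongr
    have h1 : (1 : ℝ) ≤ (L + 1) ^ 2 := one_le_pow₀ (by linarith)
    have h2 : 1 ≤ rexp (4 * m) := Real.one_le_exp (by positivity)
    nlinarith [mul_le_mul h1 h2 zero_le_one (by positivity)]

lemma contDiff_pt {v : ℝ → ℝ → ℝ} (hv : ContDiff ℝ (⊤ : ℕ∞) fun p : ℝ × ℝ => v p.1 p.2) :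
    ContDiff ℝ (⊤ : ℕ∞) fun p : ℝ × ℝ => pt v p.1 p.2 := by
  have h (p : ℝ × ℝ) : pt v p.1 p.2 = fderiv ℝ (fun p : ℝ × ℝ => v p.1 p.2) p (1, 0) := by
    have h1 := ((hv.differentiable (by simp)) p).hasFDerivAt
    exact (h1.comp_hasDerivAt_of_eq p.1
      ((hasDerivAt_id p.1).prodMk (hasDerivAt_const p.1 p.2)) rfl).deriv
  simp_rw [h]
  exact (hv.fderiv_right (m := (⊤ : ℕ∞)) (by simp)).clm_apply contDiff_const

lemma contDiff_pth {v : ℝ → ℝ → ℝ} (hv : ContDiff ℝ (⊤ : ℕ∞) fun p : ℝ × ℝ => v p.1 p.2) :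
    ContDiff ℝ (⊤ : ℕ∞) fun p : ℝ × ℝ => pth v p.1 p.2 := by
  have h (p : ℝ × ℝ) : pth v p.1 p.2 = fderiv ℝ (fun p : ℝ × ℝ => v p.1 p.2) p (0, 1) := by
    have h1 := ((hv.differentiable (by simp)) p).hasFDerivAt
    exact (h1.comp_hasDerivAt_of_eq p.2
      ((hasDerivAt_const p.2 p.1).prodMk (hasDerivAt_id p.2)) rfl).deriv
  simp_rw [h]
  exact (hv.fderiv_right (m := (⊤ : ℕ∞)) (by simp)).clm_apply contDiff_const

lemma hasDerivAt_pt {v : ℝ → ℝ → ℝ} (hv : ContDiff ℝ (⊤ : ℕ∞) fun p : ℝ × ℝ => v p.1 p.2)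
    (t θ : ℝ) : HasDerivAt (fun s => v s θ) (pt v t θ) t := by
  have h : ContDiff ℝ (⊤ : ℕ∞) fun s => v s θ := hv.comp (contDiff_id.prodMk contDiff_const)
  exact ((h.differentiable (by simp)) t).hasDerivAt

lemma hasDerivAt_pth {v : ℝ → ℝ → ℝ} (hv : ContDiff ℝ (⊤ : ℕ∞) fun p : ℝ × ℝ => v p.1 p.2)
    (t θ : ℝ) : HasDerivAt (fun s => v t s) (pth v t θ) θ := by
  have h : ContDiff ℝ (⊤ : ℕ∞) fun s => v t s := hv.comp (contDiff_const.prodMk contDiff_id)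
  exact ((h.differentiable (by simp)) θ).hasDerivAt

/-- The unnormalised Fourier coefficient of `u t` against a kernel `φ`. -/
def circlePairing (φ : ℝ → ℂ) (v : ℝ → ℝ → ℝ) (t : ℝ) : ℂ :=
  ∫ θ in (0 : ℝ)..(2 * π), (v t θ : ℂ) * φ θ

lemma hasDerivAt_circlePairing {v : ℝ → ℝ → ℝ} {φ : ℝ → ℂ}
    (hv : ContDiff ℝ (⊤ : ℕ∞) fun p : ℝ × ℝ => v p.1 p.2) (hφ : Continuous φ) (t : ℝ) :
    HasDerivAt (circlePairing φ v) (circlePairing φ (pt v) t) t := by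
  have hc : Continuous fun p : ℝ × ℝ => (v p.1 p.2 : ℂ) * φ p.2 := by
    have := hv.continuous; fun_prop
  have hc' : Continuous fun p : ℝ × ℝ => ((pt v p.1 p.2 : ℝ) : ℂ) * φ p.2 := by
    have := (contDiff_pt hv).continuous; fun_prop
  have hs (s : ℝ) : Continuous fun θ => (v s θ : ℂ) * φ θ :=
    hc.comp (by fun_prop : Continuous fun θ : ℝ => (s, θ))
  have hs' (s : ℝ) : Continuous fun θ => ((pt v s θ : ℝ) : ℂ) * φ θ :=
    hc'.comp (by fun_prop : Continuous fun θ : ℝ => (s, θ))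
  obtain ⟨C, hC⟩ := (((isCompact_Icc (a := t - 1) (b := t + 1)).prod
    (isCompact_Icc (a := 0) (b := 2 * π))).exists_bound_of_continuousOn hc'.continuousOn)
  refine (intervalIntegral.hasDerivAt_integral_of_dominated_loc_of_deriv_le
    (F := fun s θ => (v s θ : ℂ) * φ θ) (F' := fun s θ => ((pt v s θ : ℝ) : ℂ) * φ θ)
    (s := Icc (t - 1) (t + 1)) (bound := fun _ => C)
    (Icc_mem_nhds (by linarith) (by linarith))
    (Eventually.of_forall fun s => (hs s).aestronglyMeasurable)
    ((hs t).intervalIntegrable _ _) (hs' t).aestronglyMeasurable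
    (Eventually.of_forall fun θ hθ s hst => ?_) intervalIntegrable_const
    (Eventually.of_forall fun θ _ s _ => ?_)).2
  · rw [uIoc_of_le (by positivity)] at hθ
    exact hC (s, θ) ⟨hst, Ioc_subset_Icc_self hθ⟩
  · exact ((hasDerivAt_pt hv s θ).ofReal_comp).mul_const (φ θ)

/-- The conjugate character `θ ↦ e^{-ikθ}`. -/
def conjChar (k : ℤ) (θ : ℝ) : ℂ := Complex.exp (-(k * θ * Complex.I))

lemma continuous_conjChar (k : ℤ) : Continuous (conjChar k) := by
  unfold conjChar; fun_prop

lemma hasDerivAt_conjChar (k : ℤ) (θ : ℝ) :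
    HasDerivAt (conjChar k) (-(k * Complex.I) * conjChar k θ) θ := by
  have h1 : HasDerivAt (fun x : ℝ => (-(k * x * Complex.I) : ℂ)) (-(k * Complex.I)) θ := by
    simpa using ((((hasDerivAt_id θ).ofReal_comp).const_mul (k : ℂ)).mul_const Complex.I).fun_neg
  refine h1.cexp.congr_deriv ?_
  rw [conjChar]; ring

lemma conjChar_two_pi (k : ℤ) : conjChar k (2 * π) = conjChar k 0 := by
  have h := Complex.exp_int_mul_two_pi_mul_I (-k)
  simp only [conjChar]
  push_cast at h ⊢
  rw [show (-(k * (2 * π) * Complex.I) : ℂ) = -k * (2 * π * Complex.I) by ring, h]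
  simp

/-- Two integrations by parts on the circle. -/
lemma circlePairing_pth_pth {u : ℝ → ℝ → ℝ}
    (hu : ContDiff ℝ (⊤ : ℕ∞) fun p : ℝ × ℝ => u p.1 p.2)
    (hper : ∀ t θ, u t (θ + 2 * π) = u t θ) (k : ℤ) (t : ℝ) :
    circlePairing (conjChar k) (pth (pth u)) t = -(k : ℂ) ^ 2 * circlePairing (conjChar k) u t := by
  have hu1 := contDiff_pth hu
  have hu2 := contDiff_pth hu1
  have hφ := continuous_conjChar k
  have hper' : pth u t (2 * π) = pth u t 0 := by
    have : (fun s => u t (s + 2 * π)) = fun s => u t s := funext fun s => hper t s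
    simp only [pth]
    rw [← zero_add (2 * π), ← deriv_comp_add_const, this]
  have hd (θ : ℝ) : HasDerivAt
      (fun θ => (((pth u t θ : ℝ) : ℂ) + k * Complex.I * u t θ) * conjChar k θ)
      (((pth (pth u) t θ : ℝ) : ℂ) * conjChar k θ
        + (k : ℂ) ^ 2 * ((u t θ : ℂ) * conjChar k θ)) θ := by
    refine ((((hasDerivAt_pth hu1 t θ).ofReal_comp).add
      (((hasDerivAt_pth hu t θ).ofReal_comp).const_mul (k * Complex.I))).mul
      (hasDerivAt_conjChar k θ)).congr_deriv ?_
    simp only [Pi.add_apply]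
    linear_combination (-(k : ℂ) ^ 2 * u t θ * conjChar k θ) * Complex.I_sq
  have c2 : Continuous fun θ => ((pth (pth u) t θ : ℝ) : ℂ) * conjChar k θ := by
    have h := hu2.continuous.comp (by fun_prop : Continuous fun θ : ℝ => (t, θ))
    exact (Complex.continuous_ofReal.comp h).mul hφ
  have c0 : Continuous fun θ => (u t θ : ℂ) * conjChar k θ := by
    have h := hu.continuous.comp (by fun_prop : Continuous fun θ : ℝ => (t, θ))
    exact (Complex.continuous_ofReal.comp h).mul hφ
  have hint := intervalIntegral.integral_eq_sub_of_hasDerivAt (a := 0) (b := 2 * π)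
    (fun θ _ => hd θ) ((c2.add (c0.const_mul _)).intervalIntegrable _ _)
  have hu0 : u t (2 * π) = u t 0 := by simpa using hper t 0
  rw [intervalIntegral.integral_add (c2.intervalIntegrable _ _)
    ((c0.const_mul _).intervalIntegrable _ _), intervalIntegral.integral_const_mul, hper', hu0,
    conjChar_two_pi, sub_self] at hint
  rw [circlePairing, circlePairing]
  linear_combination hint

lemma hasSum_sq_circlePairing {v : ℝ → ℝ → ℝ} {t : ℝ} (hv : Continuous (v t)) :
    HasSum (fun k : ℤ => ‖circlePairing (conjChar k) v t‖ ^ 2)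
      (2 * π * ∫ θ in (0 : ℝ)..(2 * π), v t θ ^ 2) := by
  have hpi : (0 : ℝ) < 2 * π := by positivity
  have hc : Continuous fun θ => (v t θ : ℂ) := Complex.continuous_ofReal.comp hv
  obtain ⟨C, hC⟩ := (isCompact_Icc (a := 0) (b := 2 * π)).exists_bound_of_continuousOn
    hc.continuousOn
  have hL2 : MemLp (fun θ => (v t θ : ℂ)) 2 (volume.restrict (Ioc 0 (2 * π))) :=
    MemLp.of_bound hc.aestronglyMeasurable C <|
      (ae_restrict_mem measurableSet_Ioc).mono fun θ hθ => hC θ (Ioc_subset_Icc_self hθ)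
  have h := (hasSum_sq_fourierCoeffOn hpi hL2).mul_left ((2 * π) ^ 2)
  have e1 : (fun k : ℤ => ‖circlePairing (conjChar k) v t‖ ^ 2) = fun k : ℤ =>
      (2 * π) ^ 2 * ‖fourierCoeffOn hpi (fun θ => (v t θ : ℂ)) k‖ ^ 2 := by
    funext k
    rw [fourierCoeffOn_eq_integral, norm_smul, mul_pow, Real.norm_of_nonneg (by positivity),
      circlePairing]
    have : ∀ θ : ℝ, fourier (-k) (θ : AddCircle (2 * π - 0)) • (v t θ : ℂ)
        = (v t θ : ℂ) * conjChar k θ := by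
      intro θ
      rw [fourier_coe_apply, conjChar, smul_eq_mul, mul_comm]
      congr 2
      have : (π : ℂ) ≠ 0 := by exact_mod_cast Real.pi_ne_zero
      push_cast
      field_simp
      ring
    simp only [this]
    field_simp
    ring
  have e2 : 2 * π * ∫ θ in (0 : ℝ)..(2 * π), v t θ ^ 2
      = (2 * π) ^ 2 * ((2 * π - 0)⁻¹ • ∫ θ in (0 : ℝ)..(2 * π), ‖(v t θ : ℂ)‖ ^ 2) := by
    simp only [Complex.norm_real, Real.norm_eq_abs, sq_abs, smul_eq_mul, sub_zero]
    field_simp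
  rw [e1, e2]
  exact h

lemma hasSum_intervalIntegral_of_nonneg {ι : Type*} [Countable ι] {F : ι → ℝ → ℝ} {G : ℝ → ℝ}
    (hF : ∀ i, Continuous (F i)) (hF0 : ∀ i t, 0 ≤ F i t) (hG : Continuous G)
    (hFG : ∀ t, HasSum (fun i => F i t) (G t)) {a b : ℝ} (hab : a ≤ b) :
    HasSum (fun i => ∫ t in a..b, F i t) (∫ t in a..b, G t) := by
  have hI (i : ι) : Integrable (F i) (volume.restrict (Ioc a b)) :=
    ((hF i).intervalIntegrable a b).1
  simp only [intervalIntegral.integral_of_le hab]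
  have hsum : Summable fun i => ∫ t in Ioc a b, ‖F i t‖ := by
    refine summable_of_sum_le (c := ∫ t in Ioc a b, G t)
      (fun i => integral_nonneg fun t => norm_nonneg _) fun s => ?_
    simp only [Real.norm_of_nonneg (hF0 _ _)]
    rw [← integral_finsetSum _ fun i _ => hI i]
    exact integral_mono (integrable_finsetSum _ fun i _ => hI i)
      (hG.intervalIntegrable a b).1
      fun t => sum_le_hasSum s (fun i _ => hF0 i t) (hFG t)
  have := hasSum_integral_of_summable_integral_norm hI hsum
  simpa only [(hFG _).tsum_eq] using this

lemma cylInt_eq_intervalIntegral {F : ℝ → ℝ → ℝ} (hF : Continuous fun p : ℝ × ℝ => F p.1 p.2)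
    {a b : ℝ} (hab : a ≤ b) :
    cylInt F a b = ∫ t in a..b, ∫ θ in (0 : ℝ)..(2 * π), F t θ := by
  rw [cylInt, Measure.volume_eq_prod, setIntegral_prod, integral_Icc_eq_integral_Ioc,
    intervalIntegral.integral_of_le hab]
  · simp only [integral_Icc_eq_integral_Ioc,
      intervalIntegral.integral_of_le (by positivity : (0 : ℝ) ≤ 2 * π)]
  · exact hF.continuousOn.integrableOn_compact (isCompact_Icc.prod isCompact_Icc)

lemma circlePairing_ofReal (ψ : ℝ → ℝ) (v : ℝ → ℝ → ℝ) (t : ℝ) :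
    circlePairing (fun θ => (ψ θ : ℂ)) v t = ((∫ θ in (0 : ℝ)..(2 * π), v t θ * ψ θ : ℝ) : ℂ) := by
  rw [circlePairing, ← intervalIntegral.integral_ofReal]
  simp only [Complex.ofReal_mul]

lemma deriv_integral_mul {v : ℝ → ℝ → ℝ} {ψ : ℝ → ℝ}
    (hv : ContDiff ℝ (⊤ : ℕ∞) fun p : ℝ × ℝ => v p.1 p.2) (hψ : Continuous ψ) (t : ℝ) :
    deriv (fun t => ∫ θ in (0 : ℝ)..(2 * π), v t θ * ψ θ) t
      = ∫ θ in (0 : ℝ)..(2 * π), pt v t θ * ψ θ := by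
  have h := hasDerivAt_circlePairing hv (Complex.continuous_ofReal.comp hψ) t
  have h' := (Complex.reCLM.hasFDerivAt.comp_hasDerivAt t h).deriv
  simpa only [Function.comp_def, circlePairing_ofReal, Complex.reCLM_apply,
    Complex.ofReal_re] using h'

lemma circlePairing_conjChar_eq {v : ℝ → ℝ → ℝ} {t : ℝ} (hv : Continuous (v t)) (k : ℤ) :
    circlePairing (conjChar k) v t
      = ((∫ θ in (0 : ℝ)..(2 * π), v t θ * Real.cos (k * θ) : ℝ) : ℂ)
        - ((∫ θ in (0 : ℝ)..(2 * π), v t θ * Real.sin (k * θ) : ℝ) : ℂ) * Complex.I := by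
  rw [← circlePairing_ofReal, ← circlePairing_ofReal, circlePairing, circlePairing, circlePairing,
    ← intervalIntegral.integral_mul_const, ← intervalIntegral.integral_sub]
  · congr 1
    funext θ
    rw [conjChar, ← neg_mul, Complex.exp_mul_I, Complex.cos_neg, Complex.sin_neg]
    push_cast
    ring
  · exact Continuous.intervalIntegrable (by fun_prop) _ _
  · exact Continuous.intervalIntegrable (by fun_prop) _ _

/-- The mode of frequency `m` is purely decaying as soon as its real components are. -/
lemma circlePairing_pt_eq_neg_mul {u : ℝ → ℝ → ℝ} {m : ℕ}
    (hu : ContDiff ℝ (⊤ : ℕ∞) fun p : ℝ × ℝ => u p.1 p.2)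
    (hc : deriv (fun t => ∫ θ in (0 : ℝ)..(2 * π), u t θ * Real.cos ((m : ℝ) * θ)) 0
      = -(m : ℝ) * ∫ θ in (0 : ℝ)..(2 * π), u 0 θ * Real.cos ((m : ℝ) * θ))
    (hs : deriv (fun t => ∫ θ in (0 : ℝ)..(2 * π), u t θ * Real.sin ((m : ℝ) * θ)) 0
      = -(m : ℝ) * ∫ θ in (0 : ℝ)..(2 * π), u 0 θ * Real.sin ((m : ℝ) * θ))
    {k : ℤ} (hk : k.natAbs = m) :
    circlePairing (conjChar k) (pt u) 0 = -m * circlePairing (conjChar k) u 0 := by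
  rw [deriv_integral_mul hu (by fun_prop)] at hc hs
  have c0 : Continuous (u 0) :=
    hu.continuous.comp (by fun_prop : Continuous fun θ : ℝ => ((0 : ℝ), θ))
  have c1 : Continuous (pt u 0) :=
    (contDiff_pt hu).continuous.comp (by fun_prop : Continuous fun θ : ℝ => ((0 : ℝ), θ))
  rw [circlePairing_conjChar_eq c0, circlePairing_conjChar_eq c1]
  rcases Int.natAbs_eq k with h | h <;> rw [h, hk]
  · simp only [Int.cast_natCast, hc, hs]
    push_cast
    ring
  · simp only [Int.cast_neg, Int.cast_natCast, neg_mul, Real.cos_neg, Real.sin_neg, mul_neg,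
      intervalIntegral.integral_neg, hc, hs]
    push_cast
    ring

lemma circlePairing_pt_pt {u : ℝ → ℝ → ℝ}
    (hu : ContDiff ℝ (⊤ : ℕ∞) fun p : ℝ × ℝ => u p.1 p.2)
    (hper : ∀ t θ, u t (θ + 2 * π) = u t θ) {t : ℝ}
    (hharm : ∀ θ, pt (pt u) t θ + pth (pth u) t θ = 0) (k : ℤ) :
    circlePairing (conjChar k) (pt (pt u)) t = (k : ℂ) ^ 2 * circlePairing (conjChar k) u t := by
  have h := circlePairing_pth_pth hu hper k t
  have h' : circlePairing (conjChar k) (pt (pt u)) t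
      = -circlePairing (conjChar k) (pth (pth u)) t := by
    rw [circlePairing, circlePairing, ← intervalIntegral.integral_neg]
    simp only [eq_neg_of_add_eq_zero_left (hharm _), Complex.ofReal_neg, neg_mul]
  rw [h', h]
  ring

lemma cylInt_weighted_eq {u : ℝ → ℝ → ℝ} (hu : Continuous fun p : ℝ × ℝ => u p.1 p.2) (m : ℝ)
    {a b : ℝ} (hab : a ≤ b) :
    cylInt (fun t θ => u t θ ^ 2 * rexp (-(2 * m * t))) a b
      = ∫ t in a..b, (∫ θ in (0 : ℝ)..(2 * π), u t θ ^ 2) * rexp (-(2 * m * t)) := by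
  rw [cylInt_eq_intervalIntegral (by fun_prop) hab]
  simp only [intervalIntegral.integral_mul_const]

lemma continuous_integral_sq {u : ℝ → ℝ → ℝ} (hu : Continuous fun p : ℝ × ℝ => u p.1 p.2) :
    Continuous fun t => ∫ θ in (0 : ℝ)..(2 * π), u t θ ^ 2 :=
  intervalIntegral.continuous_parametric_intervalIntegral_of_continuous'
    (f := fun t θ => u t θ ^ 2) (hu.fun_pow 2) _ _

lemma cylInt_weighted_le {u : ℝ → ℝ → ℝ} {m : ℕ} (hm : 0 < m) {L : ℝ} (hL : 2 ≤ L)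
    (hu : ContDiff ℝ (⊤ : ℕ∞) fun p : ℝ × ℝ => u p.1 p.2)
    (hper : ∀ t θ, u t (θ + 2 * π) = u t θ)
    (hharm : ∀ t ∈ Icc 0 (3 * L), ∀ θ, pt (pt u) t θ + pth (pth u) t θ = 0)
    (hc : deriv (fun t => ∫ θ in (0 : ℝ)..(2 * π), u t θ * Real.cos ((m : ℝ) * θ)) 0
      = -(m : ℝ) * ∫ θ in (0 : ℝ)..(2 * π), u 0 θ * Real.cos ((m : ℝ) * θ))
    (hs : deriv (fun t => ∫ θ in (0 : ℝ)..(2 * π), u t θ * Real.sin ((m : ℝ) * θ)) 0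
      = -(m : ℝ) * ∫ θ in (0 : ℝ)..(2 * π), u 0 θ * Real.sin ((m : ℝ) * θ)) :
    cylInt (fun t θ => u t θ ^ 2 * rexp (-(2 * (m : ℝ) * t))) L (2 * L) ≤
      8 * (L + 1) ^ 2 * rexp (4 * m) * rexp (-(2 * L)) *
        (cylInt (fun t θ => u t θ ^ 2 * rexp (-(2 * (m : ℝ) * t))) 0 L
          + cylInt (fun t θ => u t θ ^ 2 * rexp (-(2 * (m : ℝ) * t))) (2 * L) (3 * L)) := by
  have hcont := hu.continuous
  have hG := continuous_integral_sq hcont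
  have hd (k : ℤ) := hasDerivAt_circlePairing hu (continuous_conjChar k)
  have hcc (k : ℤ) : Continuous (circlePairing (conjChar k) u) :=
    continuous_iff_continuousAt.2 fun t => (hd k t).continuousAt
  have hsum {a b : ℝ} (hab : a ≤ b) : HasSum
      (fun k : ℤ => ∫ t in a..b, ‖circlePairing (conjChar k) u t‖ ^ 2 * rexp (-(2 * (m : ℝ) * t)))
      (2 * π * cylInt (fun t θ => u t θ ^ 2 * rexp (-(2 * (m : ℝ) * t))) a b) := by
    rw [cylInt_weighted_eq hcont _ hab, ← intervalIntegral.integral_const_mul]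
    refine hasSum_intervalIntegral_of_nonneg (fun k => ?_) (fun k t => by positivity)
      (by fun_prop) (fun t => ?_) hab
    · have := hcc k
      fun_prop
    · rw [← mul_assoc]
      exact (hasSum_sq_circlePairing
        (hcont.comp (by fun_prop : Continuous fun θ : ℝ => (t, θ)))).mul_right _
  have hle := hasSum_le (fun k => ?_) (hsum (by linarith : L ≤ 2 * L))
    (((hsum (by linarith : 0 ≤ L)).add (hsum (by linarith : 2 * L ≤ 3 * L))).mul_left
      (8 * (L + 1) ^ 2 * rexp (4 * m) * rexp (-(2 * L))))
  · rw [← mul_add, mul_left_comm] at hle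
    exact le_of_mul_le_mul_left hle (by positivity)
  · refine integral_mode_le (κ := k.natAbs) hm hL (hd k) (fun t ht => ?_)
      (circlePairing_pt_eq_neg_mul hu hc hs)
    refine (hasDerivAt_circlePairing (contDiff_pt hu) (continuous_conjChar k) t).congr_deriv ?_
    rw [circlePairing_pt_pt hu hper (hharm t ht) k]
    congr 1
    rw [Nat.cast_natAbs, ← Int.cast_pow, ← Int.cast_pow, sq_abs]

lemma cylInt_weighted_add_pos {u : ℝ → ℝ → ℝ} {m L : ℝ} (hL : 0 < L)
    (hu : Continuous fun p : ℝ × ℝ => u p.1 p.2) (hper : ∀ t θ, u t (θ + 2 * π) = u t θ)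
    (hne : ¬∀ t ∈ Icc 0 (3 * L), ∀ θ, u t θ = 0) :
    0 < cylInt (fun t θ => u t θ ^ 2 * rexp (-(2 * m * t))) 0 L
      + cylInt (fun t θ => u t θ ^ 2 * rexp (-(2 * m * t))) L (2 * L)
      + cylInt (fun t θ => u t θ ^ 2 * rexp (-(2 * m * t))) (2 * L) (3 * L) := by
  push Not at hne
  obtain ⟨t₀, ht₀, θ₁, hθ₁⟩ := hne
  obtain ⟨θ₀, hθ₀, h⟩ := Function.Periodic.exists_mem_Ico₀ (f := u t₀) (hper t₀) two_pi_pos θ₁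
  rw [h] at hθ₁
  have hG := continuous_integral_sq hu
  have hI (a b : ℝ) : IntervalIntegrable
      (fun t => (∫ θ in (0 : ℝ)..(2 * π), u t θ ^ 2) * rexp (-(2 * m * t))) volume a b :=
    Continuous.intervalIntegrable (by fun_prop) _ _
  rw [cylInt_weighted_eq hu m hL.le, cylInt_weighted_eq hu m (by linarith),
    cylInt_weighted_eq hu m (by linarith),
    intervalIntegral.integral_add_adjacent_intervals (hI _ _) (hI _ _),
    intervalIntegral.integral_add_adjacent_intervals (hI _ _) (hI _ _)]
  refine intervalIntegral.integral_pos (by linarith) (by fun_prop) (fun t _ => ?_)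
    ⟨t₀, ht₀, ?_⟩
  · exact mul_nonneg (intervalIntegral.integral_nonneg (by positivity) fun θ _ => sq_nonneg _)
      (Real.exp_pos _).le
  · refine mul_pos (intervalIntegral.integral_pos two_pi_pos ?_ (fun θ _ => sq_nonneg _)
      ⟨θ₀, Ico_subset_Icc_self hθ₀, by positivity⟩) (Real.exp_pos _)
    exact ((hu.comp (by fun_prop : Continuous fun θ : ℝ => (t₀, θ))).pow 2).continuousOn

lemma eventually_three_circle_factor_lt (c : ℝ) {q : ℝ} (hq : q < 2) :
    ∀ᶠ L : ℝ in atTop, 8 * (L + 1) ^ 2 * rexp c * rexp (-(2 * L)) < rexp (-q * L) := by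
  have h := (isLittleO_pow_exp_pos_mul_atTop 2 (sub_pos.2 hq)).def
    (c := (64 * rexp c)⁻¹) (by positivity)
  filter_upwards [h, eventually_ge_atTop 1] with L hL h1
  rw [Real.norm_of_nonneg (by positivity), Real.norm_of_nonneg (by positivity),
    inv_mul_eq_div, le_div_iff₀ (by positivity)] at hL
  calc 8 * (L + 1) ^ 2 * rexp c * rexp (-(2 * L))
      ≤ 8 * (2 * L) ^ 2 * rexp c * rexp (-(2 * L)) := by gcongr; linarith
    _ = L ^ 2 * (64 * rexp c) * rexp (-(2 * L)) / 2 := by ring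
    _ ≤ rexp ((2 - q) * L) * rexp (-(2 * L)) / 2 := by gcongr
    _ = rexp (-q * L) / 2 := by rw [← Real.exp_add]; ring_nf
    _ < rexp (-q * L) := half_lt_self (Real.exp_pos _)

/-- **Lemma 3.2** (weighted three-circle lemma for harmonic functions). -/
theorem weighted_three_circle_harmonic (m : ℕ) (hm : 0 < m) (q : ℝ) (hq0 : 0 < q) (hq2 : q < 2) :
    ∃ L₀ > (0 : ℝ), ∀ L > L₀, ∀ u : ℝ → ℝ → ℝ,
      ContDiff ℝ (⊤ : ℕ∞) (fun p : ℝ × ℝ => u p.1 p.2) →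
      (∀ t θ : ℝ, u t (θ + 2 * π) = u t θ) →
      (∀ t ∈ Set.Icc (0 : ℝ) (3 * L), ∀ θ : ℝ, pt (pt u) t θ + pth (pth u) t θ = 0) →
      ¬(∀ t ∈ Set.Icc (0 : ℝ) (3 * L), ∀ θ : ℝ, u t θ = 0) →
      deriv (fun t => ∫ θ in (0 : ℝ)..(2 * π), u t θ * Real.cos ((m : ℝ) * θ)) 0
        = -(m : ℝ) * ∫ θ in (0 : ℝ)..(2 * π), u 0 θ * Real.cos ((m : ℝ) * θ) →
      deriv (fun t => ∫ θ in (0 : ℝ)..(2 * π), u t θ * Real.sin ((m : ℝ) * θ)) 0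
        = -(m : ℝ) * ∫ θ in (0 : ℝ)..(2 * π), u 0 θ * Real.sin ((m : ℝ) * θ) →
      cylInt (fun t θ => u t θ ^ 2 * Real.exp (-(2 * (m : ℝ) * t))) L (2 * L)
        < Real.exp (-q * L) *
          (cylInt (fun t θ => u t θ ^ 2 * Real.exp (-(2 * (m : ℝ) * t))) 0 L
            + cylInt (fun t θ => u t θ ^ 2 * Real.exp (-(2 * (m : ℝ) * t))) (2 * L) (3 * L)) := by
  obtain ⟨L₁, hL₁⟩ := eventually_atTop.1 (eventually_three_circle_factor_lt (4 * m) hq2)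
  refine ⟨max L₁ 2, by positivity, fun L hL u hu hper hharm hne hc hs => ?_⟩
  have h2 : 2 < L := (le_max_right _ _).trans_lt hL
  have hρ := hL₁ L ((le_max_left _ _).trans hL.le)
  have hle := cylInt_weighted_le hm h2.le hu hper hharm hc hs
  have hpos := cylInt_weighted_add_pos (m := m) (by linarith) hu.continuous hper hne
  refine hle.trans_lt (mul_lt_mul_of_pos_right hρ ?_)
  by_contra! hneg
  have := hle.trans (mul_nonpos_of_nonneg_of_nonpos (by positivity) hneg)
  linarith
end
end

section
/- (Weighted three-interval inequality for affine functions, Step 2 of Lemma 3.2.) For every positive integer m and every q ∈ (0,2) there exists L₀ > 0 (depending on m, q) such that for all L > L₀ and all a, b ∈ ℝ: ∫_L^{2L} (a+bt)² e^{−2mt} dt ≤ e^{−qL} ( ∫_0^L (a+bt)² e^{−2mt} dt + ∫_{2L}^{3L} (a+bt)² e^{−2mt} dt ). -/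
noncomputable section

open Real MeasureTheory Set Filter
open scoped InnerProductSpace

variable {n : ℕ}

/-- A polynomial times a constant is eventually dominated by a growing exponential. -/
theorem exists_pos_forall_gt_mul_one_add_sq_le_exp (C : ℝ) {r : ℝ} (hr : 0 < r) :
    ∃ L₀ > (0 : ℝ), ∀ L > L₀, C * (L * (1 + 4 * L ^ 2)) ≤ Real.exp (r * L) := by
  have h1 := isLittleO_pow_exp_pos_mul_atTop 1 hr
  have h3 := isLittleO_pow_exp_pos_mul_atTop 3 hr
  have h := (h1.add (h3.const_mul_left 4)).const_mul_left C
  obtain ⟨N, hN⟩ := eventually_atTop.1 (h.bound one_pos)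
  refine ⟨max N 1, by positivity, fun L hL => ?_⟩
  have hb := hN L ((le_max_left N 1).trans hL.le)
  rw [one_mul, Real.norm_eq_abs, Real.norm_eq_abs, Real.abs_exp] at hb
  calc C * (L * (1 + 4 * L ^ 2)) = C * (L ^ 1 + 4 * L ^ 3) := by ring
    _ ≤ _ := (le_abs_self _).trans hb

/-- The weighted energy of an affine function on `[0, L]`, `1 ≤ L`, controls its coefficients. -/
theorem sq_add_sq_le_integral_affine_sq_mul_exp {k L : ℝ} (hk : 0 ≤ k) (hL : 1 ≤ L) (a b : ℝ) :
    Real.exp (-k) * ((a ^ 2 + b ^ 2) / 20)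
      ≤ ∫ t in (0 : ℝ)..L, (a + b * t) ^ 2 * Real.exp (-(k * t)) := by
  have hint : ∀ x y : ℝ, IntervalIntegrable
      (fun t => (a + b * t) ^ 2 * Real.exp (-(k * t))) volume x y := fun x y =>
    Continuous.intervalIntegrable (by fun_prop) x y
  have hsplit := intervalIntegral.integral_add_adjacent_intervals (hint 0 1) (hint 1 L)
  have htail : 0 ≤ ∫ t in (1 : ℝ)..L, (a + b * t) ^ 2 * Real.exp (-(k * t)) :=
    intervalIntegral.integral_nonneg hL fun t _ => by positivity
  have hunit : ∫ t in (0 : ℝ)..1, (a + b * t) ^ 2 = a ^ 2 + a * b + b ^ 2 / 3 := by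
    have hderiv : ∀ t ∈ uIcc (0 : ℝ) 1,
        HasDerivAt (fun t => a ^ 2 * t + a * b * t ^ 2 + b ^ 2 / 3 * t ^ 3)
          ((a + b * t) ^ 2) t := fun t _ => by
      refine ((((hasDerivAt_id t).const_mul (a ^ 2)).add
        ((hasDerivAt_pow 2 t).const_mul (a * b))).add
        ((hasDerivAt_pow 3 t).const_mul (b ^ 2 / 3))).congr_deriv ?_
      norm_num
      ring
    rw [intervalIntegral.integral_eq_sub_of_hasDerivAt hderiv
      (Continuous.intervalIntegrable (by fun_prop) _ _)]
    ring
  have hmono : ∫ t in (0 : ℝ)..1, (a + b * t) ^ 2 * Real.exp (-k)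
      ≤ ∫ t in (0 : ℝ)..1, (a + b * t) ^ 2 * Real.exp (-(k * t)) := by
    refine intervalIntegral.integral_mono_on zero_le_one
      (Continuous.intervalIntegrable (by fun_prop) _ _) (hint 0 1) fun t ht => ?_
    gcongr
    exact mul_le_of_le_one_right hk ht.2
  rw [intervalIntegral.integral_mul_const, hunit, mul_comm] at hmono
  have hquad : (a ^ 2 + b ^ 2) / 20 ≤ a ^ 2 + a * b + b ^ 2 / 3 := by
    nlinarith [sq_nonneg (19 * a + 10 * b), sq_nonneg b]
  have := mul_le_mul_of_nonneg_left hquad (Real.exp_pos (-k)).le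
  linarith

/-- Upper bound for the weighted energy of an affine function on `[L, 2L]`. -/
theorem integral_affine_sq_mul_exp_le {k L : ℝ} (hk : 0 ≤ k) (hL : 0 ≤ L) (a b : ℝ) :
    ∫ t in L..(2 * L), (a + b * t) ^ 2 * Real.exp (-(k * t))
      ≤ L * (1 + 4 * L ^ 2) * (a ^ 2 + b ^ 2) * Real.exp (-(k * L)) := by
  have hmono : ∫ t in L..(2 * L), (a + b * t) ^ 2 * Real.exp (-(k * t))
      ≤ ∫ _ in L..(2 * L), (a ^ 2 + b ^ 2) * (1 + 4 * L ^ 2) * Real.exp (-(k * L)) := by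
    refine intervalIntegral.integral_mono_on (by linarith)
      (Continuous.intervalIntegrable (by fun_prop) _ _) (by simp) fun t ht => ?_
    obtain ⟨hLt, htL⟩ := ht
    have hcs : (a + b * t) ^ 2 ≤ (a ^ 2 + b ^ 2) * (1 + t ^ 2) := by
      nlinarith [sq_nonneg (a * t - b)]
    have ht2 : t ^ 2 ≤ 4 * L ^ 2 := by nlinarith
    have hpoly : (a + b * t) ^ 2 ≤ (a ^ 2 + b ^ 2) * (1 + 4 * L ^ 2) :=
      hcs.trans (by gcongr)
    gcongr
  rw [intervalIntegral.integral_const, smul_eq_mul] at hmono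
  linarith

/-- **Step 2 of Lemma 3.2** (weighted three-interval inequality for affine functions). -/
theorem weighted_three_interval_affine (m : ℕ) (hm : 0 < m) (q : ℝ) (hq0 : 0 < q) (hq2 : q < 2) :
    ∃ L₀ > (0 : ℝ), ∀ L > L₀, ∀ a b : ℝ,
      (∫ t in L..(2 * L), (a + b * t) ^ 2 * Real.exp (-(2 * (m : ℝ) * t)))
        ≤ Real.exp (-q * L) *
          ((∫ t in (0 : ℝ)..L, (a + b * t) ^ 2 * Real.exp (-(2 * (m : ℝ) * t)))
            + ∫ t in (2 * L)..(3 * L), (a + b * t) ^ 2 * Real.exp (-(2 * (m : ℝ) * t))) := by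
  have hm1 : (1 : ℝ) ≤ m := by exact_mod_cast hm
  obtain ⟨L₁, hL₁, hexp⟩ := exists_pos_forall_gt_mul_one_add_sq_le_exp
    (20 * Real.exp (2 * (m : ℝ))) (show 0 < 2 * (m : ℝ) - q by linarith)
  refine ⟨max L₁ 1, by positivity, fun L hL a b => ?_⟩
  have hL1 : 1 ≤ L := (le_max_right L₁ 1).trans hL.le
  have hk : (0 : ℝ) ≤ 2 * m := by positivity
  have hmid := integral_affine_sq_mul_exp_le hk (zero_le_one.trans hL1) a b
  have hleft := sq_add_sq_le_integral_affine_sq_mul_exp hk hL1 a b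
  have hright : 0 ≤ ∫ t in (2 * L)..(3 * L),
      (a + b * t) ^ 2 * Real.exp (-(2 * (m : ℝ) * t)) :=
    intervalIntegral.integral_nonneg (by linarith) fun t _ => by positivity
  have hcoef : L * (1 + 4 * L ^ 2) * Real.exp (-(2 * (m : ℝ) * L))
      ≤ Real.exp (-q * L) * (Real.exp (-(2 * (m : ℝ))) / 20) := by
    calc L * (1 + 4 * L ^ 2) * Real.exp (-(2 * (m : ℝ) * L))
        = 20 * Real.exp (2 * (m : ℝ)) * (L * (1 + 4 * L ^ 2)) *
            (Real.exp (-(2 * (m : ℝ))) / 20 * Real.exp (-(2 * (m : ℝ) * L))) := by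
          rw [Real.exp_neg (2 * (m : ℝ))]
          field_simp
      _ ≤ Real.exp ((2 * (m : ℝ) - q) * L) *
            (Real.exp (-(2 * (m : ℝ))) / 20 * Real.exp (-(2 * (m : ℝ) * L))) := by
          gcongr
          exact hexp L ((le_max_left L₁ 1).trans_lt hL)
      _ = Real.exp ((2 * (m : ℝ) - q) * L) * Real.exp (-(2 * (m : ℝ) * L)) *
            (Real.exp (-(2 * (m : ℝ))) / 20) := by ring
      _ = _ := by
          rw [← Real.exp_add]
          congr 2
          ring
  calc _ ≤ L * (1 + 4 * L ^ 2) * (a ^ 2 + b ^ 2) * Real.exp (-(2 * (m : ℝ) * L)) := hmid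
    _ = L * (1 + 4 * L ^ 2) * Real.exp (-(2 * (m : ℝ) * L)) * (a ^ 2 + b ^ 2) := by ring
    _ ≤ Real.exp (-q * L) * (Real.exp (-(2 * (m : ℝ))) / 20) * (a ^ 2 + b ^ 2) := by gcongr
    _ = Real.exp (-q * L) * (Real.exp (-(2 * (m : ℝ))) * ((a ^ 2 + b ^ 2) / 20)) := by ring
    _ ≤ _ := by
      gcongr
      linarith
end
end

section
/- (Weighted three-interval inequality for single Fourier modes, Step 1 of Lemma 3.2.) For every positive integer m there exist C > 0 and L₀ > 0 (depending only on m) such that for all L > L₀, every positive integer k, and all a, b ∈ ℝ with b = 0 in the case k = m: ∫_L^{2L} (a e^{−kt} + b e^{kt})² e^{−2mt} dt ≤ C e^{−2L} ( ∫_0^L (a e^{−kt} + b e^{kt})² e^{−2mt} dt + ∫_{2L}^{3L} (a e^{−kt} + b e^{kt})² e^{−2mt} dt ). -/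
noncomputable section

open Real MeasureTheory Set Filter
open scoped InnerProductSpace

variable {n : ℕ}

theorem intervalIntegral_exp_shift (p τ x y : ℝ) :
    ∫ t in (x + τ)..(y + τ), Real.exp (p * t) ^ 2
      = Real.exp (p * τ) ^ 2 * ∫ t in x..y, Real.exp (p * t) ^ 2 := by
  rw [← intervalIntegral.integral_comp_add_right, ← intervalIntegral.integral_const_mul]
  congr 1
  funext t
  rw [mul_add, Real.exp_add]
  ring

/-- Upper bound for the energy of a sum of two exponentials by the separate energies. -/
theorem integral_sq_add_exp_le (a c p q : ℝ) {x y : ℝ} (hxy : x ≤ y) :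
    ∫ t in x..y, (a * Real.exp (p * t) + c * Real.exp (q * t)) ^ 2
      ≤ 2 * (a ^ 2 * (∫ t in x..y, Real.exp (p * t) ^ 2)
          + c ^ 2 * ∫ t in x..y, Real.exp (q * t) ^ 2) := by
  rw [← intervalIntegral.integral_const_mul, ← intervalIntegral.integral_const_mul,
    ← intervalIntegral.integral_add (Continuous.intervalIntegrable (by fun_prop) _ _)
      (Continuous.intervalIntegrable (by fun_prop) _ _), ← intervalIntegral.integral_const_mul]
  refine intervalIntegral.integral_mono_on hxy (Continuous.intervalIntegrable (by fun_prop) _ _)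
    (Continuous.intervalIntegrable (by fun_prop) _ _) fun t _ => ?_
  nlinarith [sq_nonneg (a * Real.exp (p * t) - c * Real.exp (q * t))]

/-- Lower bound for the energy of a sum of two exponentials, dominated by the first one. -/
theorem le_integral_sq_add_exp (a c p q : ℝ) {x y : ℝ} (hxy : x ≤ y) :
    a ^ 2 / 2 * (∫ t in x..y, Real.exp (p * t) ^ 2) - c ^ 2 * (∫ t in x..y, Real.exp (q * t) ^ 2)
      ≤ ∫ t in x..y, (a * Real.exp (p * t) + c * Real.exp (q * t)) ^ 2 := by
  rw [← intervalIntegral.integral_const_mul, ← intervalIntegral.integral_const_mul,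
    ← intervalIntegral.integral_sub (Continuous.intervalIntegrable (by fun_prop) _ _)
      (Continuous.intervalIntegrable (by fun_prop) _ _)]
  refine intervalIntegral.integral_mono_on hxy (Continuous.intervalIntegrable (by fun_prop) _ _)
    (Continuous.intervalIntegrable (by fun_prop) _ _) fun t _ => ?_
  nlinarith [sq_nonneg (a * Real.exp (p * t) + 2 * (c * Real.exp (q * t)))]

theorem integral_exp_sq_nonneg (p : ℝ) {x y : ℝ} (hxy : x ≤ y) :
    0 ≤ ∫ t in x..y, Real.exp (p * t) ^ 2 :=
  intervalIntegral.integral_nonneg hxy fun _ _ => sq_nonneg _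

theorem exp_mul_sq_le {p x : ℝ} (hp : p ≤ -1) (hx : 0 ≤ x) :
    Real.exp (p * x) ^ 2 ≤ Real.exp (-2 * x) := by
  rw [← Real.exp_nat_mul]
  exact Real.exp_le_exp.2 (by push_cast; nlinarith)

/-- Three-interval inequality for a decaying and a growing exponential. -/
theorem three_interval_saddle {p q L : ℝ} (hp : p ≤ -1) (hq : 1 ≤ q) (hL : 1 ≤ L) (a b : ℝ) :
    ∫ t in L..(2 * L), (a * Real.exp (p * t) + b * Real.exp (q * t)) ^ 2
      ≤ 8 * Real.exp (-2 * L) *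
        ((∫ t in (0 : ℝ)..L, (a * Real.exp (p * t) + b * Real.exp (q * t)) ^ 2)
          + ∫ t in (2 * L)..(3 * L), (a * Real.exp (p * t) + b * Real.exp (q * t)) ^ 2) := by
  have h₁ := integral_sq_add_exp_le a b p q (show L ≤ 2 * L by linarith)
  have h₀ := le_integral_sq_add_exp a b p q (show 0 ≤ L by linarith)
  have h₂ := le_integral_sq_add_exp b a q p (show 2 * L ≤ 3 * L by linarith)
  simp only [add_comm (b * Real.exp _)] at h₂
  have s₁ := intervalIntegral_exp_shift p L 0 L
  have s₂ := intervalIntegral_exp_shift p L L (2 * L)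
  have s₃ := intervalIntegral_exp_shift q (-L) L (2 * L)
  have s₄ := intervalIntegral_exp_shift q (-L) (2 * L) (3 * L)
  rw [show 0 + L = L by ring, show L + L = 2 * L by ring] at s₁
  rw [show L + L = 2 * L by ring, show 2 * L + L = 3 * L by ring] at s₂
  rw [show L + -L = 0 by ring, show 2 * L + -L = L by ring] at s₃
  rw [show 2 * L + -L = L by ring, show 3 * L + -L = 2 * L by ring] at s₄
  have eA : Real.exp (p * L) ^ 2 ≤ Real.exp (-2 * L) := exp_mul_sq_le hp (by linarith)
  have eB : Real.exp (q * -L) ^ 2 ≤ Real.exp (-2 * L) := by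
    have := exp_mul_sq_le (p := -q) (by linarith) (show 0 ≤ L by linarith)
    rwa [neg_mul, ← mul_neg] at this
  have eE : Real.exp (-2 * L) ≤ 1 / 2 := by
    have h : Real.exp (-2 * L) ≤ Real.exp (-1) := Real.exp_le_exp.2 (by linarith)
    linarith [Real.exp_neg_one_lt_half]
  have hA := integral_exp_sq_nonneg p (show 0 ≤ L by linarith)
  have hB := integral_exp_sq_nonneg q (show 2 * L ≤ 3 * L by linarith)
  rw [s₂, s₁] at h₂
  rw [s₃, s₄] at h₀
  rw [s₁, s₄] at h₁
  generalize (∫ t in (0 : ℝ)..L, Real.exp (p * t) ^ 2) = A at *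
  generalize (∫ t in (2 * L)..(3 * L), Real.exp (q * t) ^ 2) = B at *
  generalize (∫ t in (0 : ℝ)..L, (a * Real.exp (p * t) + b * Real.exp (q * t)) ^ 2) = I₀ at *
  generalize (∫ t in L..(2 * L), (a * Real.exp (p * t) + b * Real.exp (q * t)) ^ 2) = I₁ at *
  generalize (∫ t in (2 * L)..(3 * L), (a * Real.exp (p * t) + b * Real.exp (q * t)) ^ 2)
    = I₂ at *
  have hE : 0 < Real.exp (-2 * L) := Real.exp_pos _
  have rA : 0 ≤ Real.exp (p * L) ^ 2 := sq_nonneg _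
  have rB : 0 ≤ Real.exp (q * -L) ^ 2 := sq_nonneg _
  generalize Real.exp (p * L) ^ 2 = r at *
  generalize Real.exp (q * -L) ^ 2 = s at *
  generalize Real.exp (-2 * L) = E at *
  have hX : 0 ≤ a ^ 2 * A := by positivity
  have hY : 0 ≤ b ^ 2 * B := by positivity
  have hr : r * r ≤ 1 / 4 := by nlinarith
  have hs : s * s ≤ 1 / 4 := by nlinarith
  have lower : a ^ 2 * A + b ^ 2 * B ≤ 4 * (I₀ + I₂) := by
    nlinarith [mul_le_mul_of_nonneg_right hr hX, mul_le_mul_of_nonneg_right hs hY]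
  have upper : I₁ ≤ 2 * E * (a ^ 2 * A + b ^ 2 * B) := by
    nlinarith [mul_le_mul_of_nonneg_right eA hX, mul_le_mul_of_nonneg_right eB hY]
  nlinarith [mul_le_mul_of_nonneg_left lower hE.le]

theorem integral_exp_sq_le_two_mul {p L : ℝ} (hp : p ≤ 0) (hL : 2 ≤ L) :
    ∫ t in (0 : ℝ)..L, Real.exp (p * t) ^ 2
      ≤ 2 * ∫ t in (0 : ℝ)..(L - 1), Real.exp (p * t) ^ 2 := by
  have hi : ∀ x y, IntervalIntegrable (fun t => Real.exp (p * t) ^ 2) volume x y :=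
    fun x y => Continuous.intervalIntegrable (by fun_prop) _ _
  have split₁ := intervalIntegral.integral_add_adjacent_intervals (hi 0 1) (hi 1 L)
  have split₂ := intervalIntegral.integral_add_adjacent_intervals (hi 0 1) (hi 1 (L - 1))
  have s := intervalIntegral_exp_shift p 1 0 (L - 1)
  rw [zero_add, sub_add_cancel] at s
  have hr : Real.exp (p * 1) ^ 2 ≤ 1 :=
    pow_le_one₀ (Real.exp_pos _).le (Real.exp_le_one_iff.2 (by linarith))
  have h₁ := integral_exp_sq_nonneg p (show 1 ≤ L - 1 by linarith)
  have h₂ := integral_exp_sq_nonneg p (show 0 ≤ L - 1 by linarith)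
  nlinarith

theorem separate_sq_le {r s δ : ℝ} (hr : 0 ≤ r) (hr₁ : r ≤ 1) (hs : 0 ≤ s) (hs₁ : s ≤ 1)
    (hδ : 0 ≤ δ) (hδ' : δ ≤ s - r) (x y : ℝ) :
    δ ^ 2 * (x ^ 2 + y ^ 2) ≤ 4 * ((x + y) ^ 2 + (x * r + y * s) ^ 2) := by
  have hd : δ ^ 2 ≤ (s - r) ^ 2 := pow_le_pow_left₀ hδ hδ' 2
  have h2r : r ^ 2 ≤ 1 := pow_le_one₀ hr hr₁
  have h2s : s ^ 2 ≤ 1 := pow_le_one₀ hs hs₁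
  have e₁ : (s - r) ^ 2 * x ^ 2 ≤ 2 * ((x + y) ^ 2 + (x * r + y * s) ^ 2) := by
    nlinarith [sq_nonneg (s * (x + y) + (x * r + y * s)),
      mul_le_mul_of_nonneg_right h2s (sq_nonneg (x + y))]
  have e₂ : (s - r) ^ 2 * y ^ 2 ≤ 2 * ((x + y) ^ 2 + (x * r + y * s) ^ 2) := by
    nlinarith [sq_nonneg (r * (x + y) + (x * r + y * s)),
      mul_le_mul_of_nonneg_right h2r (sq_nonneg (x + y))]
  nlinarith [mul_le_mul_of_nonneg_right hd (add_nonneg (sq_nonneg x) (sq_nonneg y))]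

/-- Quantitative linear independence of two non-growing exponentials. -/
theorem separate_energies_le {p q δ L : ℝ} (hp : p ≤ 0) (hq : q ≤ 0) (hδ : 0 < δ)
    (hδ' : δ ≤ Real.exp q - Real.exp p) (hL : 2 ≤ L) (a b : ℝ) :
    a ^ 2 * (∫ t in (0 : ℝ)..L, Real.exp (p * t) ^ 2)
        + b ^ 2 * (∫ t in (0 : ℝ)..L, Real.exp (q * t) ^ 2)
      ≤ 16 / δ ^ 2 * ∫ t in (0 : ℝ)..L, (a * Real.exp (p * t) + b * Real.exp (q * t)) ^ 2 := by
  set g : ℝ → ℝ := fun t => (a * Real.exp (p * t) + b * Real.exp (q * t)) ^ 2 with hg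
  have hgc : Continuous g := by fun_prop
  have hgi : ∀ x y, IntervalIntegrable g volume x y := fun x y => hgc.intervalIntegrable _ _
  have key : δ ^ 2 * (a ^ 2 * (∫ t in (0 : ℝ)..(L - 1), Real.exp (p * t) ^ 2)
        + b ^ 2 * (∫ t in (0 : ℝ)..(L - 1), Real.exp (q * t) ^ 2))
      ≤ 4 * ((∫ t in (0 : ℝ)..(L - 1), g t) + ∫ t in (0 : ℝ)..(L - 1), g (t + 1)) := by
    rw [← intervalIntegral.integral_const_mul, ← intervalIntegral.integral_const_mul,
      ← intervalIntegral.integral_add (Continuous.intervalIntegrable (by fun_prop) _ _)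
        (Continuous.intervalIntegrable (by fun_prop) _ _),
      ← intervalIntegral.integral_add (Continuous.intervalIntegrable (by fun_prop) _ _)
        (Continuous.intervalIntegrable (by fun_prop) _ _),
      ← intervalIntegral.integral_const_mul, ← intervalIntegral.integral_const_mul]
    refine intervalIntegral.integral_mono_on (by linarith)
      (Continuous.intervalIntegrable (by fun_prop) _ _)
      (Continuous.intervalIntegrable (by fun_prop) _ _) fun t _ => ?_
    simp only [hg, mul_add, mul_one, Real.exp_add]
    have := separate_sq_le (Real.exp_pos p).le (Real.exp_le_one_iff.2 hp) (Real.exp_pos q).le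
      (Real.exp_le_one_iff.2 hq) hδ.le hδ' (a * Real.exp (p * t)) (b * Real.exp (q * t))
    simp only [mul_pow, mul_assoc, mul_add] at this ⊢
    exact this
  rw [intervalIntegral.integral_comp_add_right, zero_add, sub_add_cancel] at key
  have s₁ := intervalIntegral.integral_add_adjacent_intervals (hgi 0 (L - 1)) (hgi (L - 1) L)
  have s₂ := intervalIntegral.integral_add_adjacent_intervals (hgi 0 1) (hgi 1 L)
  have n₁ : 0 ≤ ∫ t in (L - 1)..L, g t :=
    intervalIntegral.integral_nonneg (by linarith) fun _ _ => sq_nonneg _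
  have n₂ : 0 ≤ ∫ t in (0 : ℝ)..1, g t :=
    intervalIntegral.integral_nonneg (by linarith) fun _ _ => sq_nonneg _
  have hA := mul_le_mul_of_nonneg_left (integral_exp_sq_le_two_mul hp hL) (sq_nonneg a)
  have hB := mul_le_mul_of_nonneg_left (integral_exp_sq_le_two_mul hq hL) (sq_nonneg b)
  rw [div_mul_eq_mul_div, le_div_iff₀ (by positivity)]
  nlinarith [mul_le_mul_of_nonneg_left (add_le_add hA hB) (sq_nonneg δ)]

/-- Two-interval inequality for two decaying exponentials. -/
theorem two_interval_decay {p q δ L : ℝ} (hp : p ≤ -1) (hq : q ≤ 0) (hδ : 0 < δ)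
    (hδ' : δ ≤ Real.exp q - Real.exp p) (hL : 2 ≤ L) (a b : ℝ) (hb : b = 0 ∨ q ≤ -1) :
    ∫ t in L..(2 * L), (a * Real.exp (p * t) + b * Real.exp (q * t)) ^ 2
      ≤ 32 / δ ^ 2 * Real.exp (-2 * L) *
        ∫ t in (0 : ℝ)..L, (a * Real.exp (p * t) + b * Real.exp (q * t)) ^ 2 := by
  have h₁ := integral_sq_add_exp_le a b p q (show L ≤ 2 * L by linarith)
  have s₁ := intervalIntegral_exp_shift p L 0 L
  have s₂ := intervalIntegral_exp_shift q L 0 L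
  rw [show 0 + L = L by ring, show L + L = 2 * L by ring] at s₁ s₂
  have hA := integral_exp_sq_nonneg p (show 0 ≤ L by linarith)
  have hB := integral_exp_sq_nonneg q (show 0 ≤ L by linarith)
  have sep := separate_energies_le (by linarith) hq hδ hδ' hL a b
  have eA := mul_le_mul_of_nonneg_right (exp_mul_sq_le hp (show 0 ≤ L by linarith))
    (mul_nonneg (sq_nonneg a) hA)
  have eB : Real.exp (q * L) ^ 2 * (b ^ 2 * ∫ t in (0 : ℝ)..L, Real.exp (q * t) ^ 2)
      ≤ Real.exp (-2 * L) * (b ^ 2 * ∫ t in (0 : ℝ)..L, Real.exp (q * t) ^ 2) := by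
    rcases hb with rfl | hq'
    · simp
    · exact mul_le_mul_of_nonneg_right (exp_mul_sq_le hq' (by linarith))
        (mul_nonneg (sq_nonneg b) hB)
  rw [s₁, s₂] at h₁
  have := mul_le_mul_of_nonneg_left sep (Real.exp_pos (-2 * L)).le
  rw [show (32 : ℝ) / δ ^ 2 = 2 * (16 / δ ^ 2) by ring]
  linarith

/-- **Step 1 of Lemma 3.2** (weighted three-interval inequality for single Fourier modes). -/
theorem weighted_three_interval_mode (m : ℕ) (hm : 0 < m) :
    ∃ C > (0 : ℝ), ∃ L₀ > (0 : ℝ), ∀ L > L₀, ∀ k : ℕ, 0 < k → ∀ a b : ℝ, (k = m → b = 0) →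
      (∫ t in L..(2 * L),
          (a * Real.exp (-((k : ℝ) * t)) + b * Real.exp ((k : ℝ) * t)) ^ 2
            * Real.exp (-(2 * (m : ℝ) * t)))
        ≤ C * Real.exp (-2 * L) *
          ((∫ t in (0 : ℝ)..L,
              (a * Real.exp (-((k : ℝ) * t)) + b * Real.exp ((k : ℝ) * t)) ^ 2
                * Real.exp (-(2 * (m : ℝ) * t)))
            + ∫ t in (2 * L)..(3 * L),
                (a * Real.exp (-((k : ℝ) * t)) + b * Real.exp ((k : ℝ) * t)) ^ 2
                  * Real.exp (-(2 * (m : ℝ) * t))) := by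
  refine ⟨32 * Real.exp m ^ 2, by positivity, 2, by norm_num, fun L hL k hk a b hab => ?_⟩
  have hm1 : (1 : ℝ) ≤ m := by exact_mod_cast hm
  have hk1 : (1 : ℝ) ≤ k := by exact_mod_cast hk
  have rewr : ∀ t : ℝ, (a * Real.exp (-((k : ℝ) * t)) + b * Real.exp ((k : ℝ) * t)) ^ 2
      * Real.exp (-(2 * (m : ℝ) * t))
      = (a * Real.exp ((-k - m) * t) + b * Real.exp ((k - m) * t)) ^ 2 := by
    intro t
    rw [show -(2 * (m : ℝ) * t) = -(m * t) + -(m * t) by ring,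
      show (-(k : ℝ) - m) * t = -(k * t) + -(m * t) by ring,
      show ((k : ℝ) - m) * t = k * t + -(m * t) by ring, Real.exp_add, Real.exp_add, Real.exp_add]
    ring
  simp only [rewr]
  have n₀ : 0 ≤ ∫ t in (0 : ℝ)..L,
      (a * Real.exp ((-k - m) * t) + b * Real.exp ((k - m) * t)) ^ 2 :=
    intervalIntegral.integral_nonneg (by linarith) fun _ _ => sq_nonneg _
  have n₂ : 0 ≤ ∫ t in (2 * L)..(3 * L),
      (a * Real.exp ((-k - m) * t) + b * Real.exp ((k - m) * t)) ^ 2 :=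
    intervalIntegral.integral_nonneg (by linarith) fun _ _ => sq_nonneg _
  rcases le_or_gt k m with hkm | hkm
  · have hkm' : (k : ℝ) ≤ m := by exact_mod_cast hkm
    have hδ : Real.exp (-m) ≤ Real.exp (k - m) - Real.exp (-k - m) := by
      rw [sub_eq_add_neg (k : ℝ), sub_eq_add_neg (-k : ℝ), Real.exp_add, Real.exp_add]
      have h₁ := Real.add_one_le_exp (k : ℝ)
      have h₂ : Real.exp (-k : ℝ) ≤ 1 := Real.exp_le_one_iff.2 (by linarith)
      nlinarith [Real.exp_pos (-m : ℝ)]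
    have hb : b = 0 ∨ (k : ℝ) - m ≤ -1 := by
      rcases hkm.eq_or_lt with h | h
      · exact Or.inl (hab h)
      · have : (k : ℝ) + 1 ≤ m := by exact_mod_cast h
        exact Or.inr (by linarith)
    have main := two_interval_decay (by linarith) (by linarith) (Real.exp_pos _) hδ hL.le a b hb
    rw [Real.exp_neg, inv_pow, div_inv_eq_mul] at main
    refine main.trans (mul_le_mul_of_nonneg_left (by linarith) (by positivity))
  · have hkm' : (m : ℝ) + 1 ≤ k := by exact_mod_cast hkm
    refine (three_interval_saddle (by linarith) (by linarith) (by linarith) a b).trans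
      (mul_le_mul_of_nonneg_right ?_ (add_nonneg n₀ n₂))
    have : 1 ≤ Real.exp (m : ℝ) ^ 2 := one_le_pow₀ (Real.one_le_exp (by linarith))
    exact mul_le_mul_of_nonneg_right (by linarith) (Real.exp_pos _).le
end
end
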